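/- arXiv:1205.2177 — 15 statements merged into one kernel-verified Lean document; each statement's English description precedes it below -/
import Mathlib

section
/- Let G be a finite simple connected graph of order n and diameter D ≥ 3. Then η(G) ≤ n − ⌈2D/3⌉. -/
open SimpleGraph

variable {V : Type*}

/-- `D` is a dominating set of `G`: every vertex outside `D` has a neighbor in `D`. -/
def Dominating (G : SimpleGraph V) (D : Set V) : Prop :=
  ∀ v ∉ D, ∃ u ∈ D, G.Adj u v

/-- `S` is a locating set of `G`: distinct vertices have distinct vectors of
distances to the vertices of `S`. -/
def Locating (G : SimpleGraph V) (S : Set V) : Prop :=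
  ∀ u v : V, u ≠ v → ∃ x ∈ S, G.dist u x ≠ G.dist v x

/-- `D` is a locating-dominating set of `G`: it is dominating and distinct vertices
outside `D` have distinct (nonempty) neighborhoods within `D`. -/
def LocatingDominating (G : SimpleGraph V) (D : Set V) : Prop :=
  Dominating G D ∧
  ∀ u ∉ D, ∀ v ∉ D, u ≠ v → (G.neighborSet u ∩ D) ≠ (G.neighborSet v ∩ D)

/-- The domination number `γ(G)`. -/
noncomputable def domNum (G : SimpleGraph V) : ℕ :=
  sInf {k | ∃ D : Set V, Dominating G D ∧ D.ncard = k}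

/-- The metric dimension `β(G)`. -/
noncomputable def metricDim (G : SimpleGraph V) : ℕ :=
  sInf {k | ∃ S : Set V, Locating G S ∧ S.ncard = k}

/-- The metric-location-domination number `η(G)`. -/
noncomputable def mldNum (G : SimpleGraph V) : ℕ :=
  sInf {k | ∃ S : Set V, Dominating G S ∧ Locating G S ∧ S.ncard = k}

/-- The location-domination number `λ(G)`. -/
noncomputable def locDomNum (G : SimpleGraph V) : ℕ :=
  sInf {k | ∃ D : Set V, LocatingDominating G D ∧ D.ncard = k}

/-- A connected finite graph contains an isometrically embedded path of length `G.diam`. -/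
theorem exists_isometric_path [Finite V] (G : SimpleGraph V) (hG : G.Connected) :
    ∃ p : ℕ → V, (∀ i < G.diam, G.Adj (p i) (p (i + 1))) ∧
      ∀ i j, i ≤ j → j ≤ G.diam → G.dist (p i) (p j) = j - i := by
  have := hG.nonempty
  obtain ⟨u, v, huv⟩ := G.exists_dist_eq_diam
  obtain ⟨w, hw⟩ := hG.exists_walk_length_eq_dist u v
  have hadj : ∀ i < G.diam, G.Adj (w.getVert i) (w.getVert (i + 1)) := fun i hi =>
    w.adj_getVert_succ (by omega)
  have hle : ∀ k i, i + k ≤ G.diam → G.dist (w.getVert i) (w.getVert (i + k)) ≤ k := by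
    intro k
    induction k with
    | zero => simp
    | succ k ih =>
      intro i hi
      have h1 := ih i (by omega)
      have h2 := dist_eq_one_iff_adj.2 (hadj (i + k) (by omega))
      have h3 := hG.dist_triangle (u := w.getVert i) (v := w.getVert (i + k))
        (w := w.getVert (i + k + 1))
      rw [← add_assoc]
      omega
  refine ⟨w.getVert, hadj, fun i j hij hj => ?_⟩
  have h1 := hle i 0 (by omega)
  have h2 := hle (j - i) i (by omega)
  have h3 := hle (G.diam - j) j (by omega)
  have h4 : G.dist u v ≤ _ := hG.dist_triangle (v := w.getVert i)
  have h5 : G.dist (w.getVert i) v ≤ _ := hG.dist_triangle (v := w.getVert j)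
  rw [zero_add, w.getVert_zero] at h1
  rw [Nat.add_sub_cancel' hij] at h2
  rw [Nat.add_sub_cancel' hj, ← huv, ← hw, w.getVert_length] at h3
  omega

theorem stmt1 [Fintype V] (G : SimpleGraph V) (hG : G.Connected) (hD : 3 ≤ G.diam) :
    (mldNum G : ℤ) ≤ (Fintype.card V : ℤ) - ⌈(2 * (G.diam : ℚ)) / 3⌉ := by
  classical
  obtain ⟨p, hadj, hdist⟩ := exists_isometric_path G hG
  set d := G.diam with hd
  have hinj : ∀ i j, i ≤ d → j ≤ d → p i = p j → i = j := by
    intro i j hi hj h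
    rcases le_total i j with hij | hij
    · have := hdist i j hij hj
      rw [h, SimpleGraph.dist_self] at this
      omega
    · have := hdist j i hij hi
      rw [h, SimpleGraph.dist_self] at this
      omega
  set r := (2 * d + 2) / 3 with hr
  -- Drop the path vertices whose index is not `1` modulo `3`, except a last index divisible by `3`.
  set W : Finset V := (Finset.range r).image fun m => p ((3 * m + 1) / 2) with hW
  have hcard : W.card = r := by
    rw [hW, Finset.card_image_of_injOn, Finset.card_range]
    intro a ha b hb hab
    simp only [Finset.coe_range, Set.mem_Iio] at ha hb
    have := hinj _ _ (by omega) (by omega) hab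
    omega
  have hmem : ∀ v ∈ W, ∃ m < r, p ((3 * m + 1) / 2) = v := by
    intro v hv
    simpa [hW] using hv
  have hkeep : ∀ i ≤ d, (i % 3 = 1 ∨ i = d ∧ i % 3 = 0) → p i ∈ ((Wᶜ : Finset V) : Set V) := by
    intro i hi h
    rw [Finset.mem_coe, Finset.mem_compl]
    intro hiW
    obtain ⟨m, hm, hmi⟩ := hmem _ hiW
    have := hinj _ _ (by omega) hi hmi
    omega
  have hdom : Dominating G ((Wᶜ : Finset V) : Set V) := by
    intro v hv
    obtain ⟨m, hm, rfl⟩ := hmem v (by simpa using hv)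
    obtain ⟨i, hi⟩ : ∃ i, (3 * m + 1) / 2 = i := ⟨_, rfl⟩
    rw [hi]
    by_cases h : i % 3 = 0
    · exact ⟨p (i + 1), hkeep _ (by omega) (by omega), (hadj i (by omega)).symm⟩
    · obtain ⟨k, rfl⟩ : ∃ k, i = k + 1 := ⟨i - 1, by omega⟩
      exact ⟨p k, hkeep _ (by omega) (by omega), hadj k (by omega)⟩
  have hloc : Locating G ((Wᶜ : Finset V) : Set V) := by
    intro u v huv
    by_cases hu : u ∈ ((Wᶜ : Finset V) : Set V)
    · refine ⟨u, hu, ?_⟩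
      rw [SimpleGraph.dist_self]
      exact (hG.pos_dist_of_ne huv.symm).ne
    by_cases hv : v ∈ ((Wᶜ : Finset V) : Set V)
    · refine ⟨v, hv, ?_⟩
      rw [SimpleGraph.dist_self]
      exact (hG.pos_dist_of_ne huv).ne'
    obtain ⟨a, ha, hau⟩ := hmem u (by simpa using hu)
    obtain ⟨b, hb, hbv⟩ := hmem v (by simpa using hv)
    have hab : a ≠ b := by
      rintro rfl
      exact huv (hau.symm.trans hbv)
    have hdist' : ∀ i j, i ≤ d → j ≤ d → G.dist (p i) (p j) = (j - i) + (i - j) := by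
      intro i j hi hj
      rcases le_total i j with hij | hij
      · rw [hdist i j hij hj]
        omega
      · rw [SimpleGraph.dist_comm, hdist j i hij hi]
        omega
    obtain ⟨k, hk1, hkd, hk⟩ : ∃ k, 1 < k ∧ k ≤ d ∧ (k % 3 = 1 ∨ k = d ∧ k % 3 = 0) := by
      rcases hD.eq_or_lt with h | h
      · exact ⟨3, by omega⟩
      · exact ⟨4, by omega⟩
    by_contra! hcon
    have h1 := hcon _ (hkeep 1 (by omega) (by omega))
    have h2 := hcon _ (hkeep k hkd hk)
    rw [← hau, ← hbv, hdist' _ _ (by omega) (by omega), hdist' _ _ (by omega) (by omega)] at h1 h2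
    omega
  have hle : mldNum G ≤ Fintype.card V - r := by
    refine Nat.sInf_le ⟨_, hdom, hloc, ?_⟩
    rw [Set.ncard_coe_finset, Finset.card_compl, hcard]
  have hrV : r ≤ Fintype.card V := hcard ▸ W.card_le_univ
  have hceil : ⌈(2 * (d : ℚ)) / 3⌉ ≤ (r : ℤ) := by
    rw [Int.ceil_le, div_le_iff₀ (by norm_num)]
    have : 2 * d ≤ r * 3 := by omega
    exact_mod_cast this
  omega
end

section
/- Let G be a finite simple connected graph of order n and diameter at least 3, and let η = η(G). Then n ≤ η + η·3^(η−1). -/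
open SimpleGraph

variable {V : Type*}

/-- A locating set of a finite connected graph restricts how many of the vertices adjacent to one
of its members can lie outside it: at each of the other members their distances take at most
three values. -/
theorem Locating.card_neighbors_compl_le [Fintype V] [DecidableEq V] {G : SimpleGraph V}
    [DecidableRel G.Adj] (hG : G.Connected) {S : Finset V} (hS : Locating G (S : Set V))
    {x : V} (hx : x ∈ S) : (Sᶜ.filter (G.Adj x)).card ≤ 3 ^ (S.card - 1) := by
  have hadj {v : V} (hv : v ∈ Sᶜ.filter (G.Adj x)) : G.dist x v = 1 :=
    dist_eq_one_iff_adj.2 (Finset.mem_filter.1 hv).2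
  have hlow {v : V} (hv : v ∈ Sᶜ.filter (G.Adj x)) (y : V) :
      G.dist x y ≤ G.dist v y + 1 := by
    have := hG.dist_triangle (u := x) (v := v) (w := y)
    have := hadj hv
    omega
  have hupp {v : V} (hv : v ∈ Sᶜ.filter (G.Adj x)) (y : V) :
      G.dist v y ≤ G.dist x y + 1 := by
    have := hG.dist_triangle (u := v) (v := x) (w := y)
    rw [G.dist_comm (u := v) (v := x), hadj hv] at this
    omega
  let f (v : V) : S.erase x → Fin 3 := fun y => Fin.ofNat 3 (G.dist v y + 1 - G.dist x y)
  have hf : Set.InjOn f (Sᶜ.filter (G.Adj x)) := by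
    intro u hu v hv huv
    by_contra hne
    obtain ⟨y, hy, hdist⟩ := hS u v hne
    rw [Finset.mem_coe] at hu hv hy
    by_cases hyx : y = x
    · subst hyx
      exact hdist (by rw [G.dist_comm, hadj hu, G.dist_comm, hadj hv])
    · have h := congrArg Fin.val (congrFun huv ⟨y, Finset.mem_erase.2 ⟨hyx, hy⟩⟩)
      simp only [f, Fin.ofNat] at h
      have := hlow hu y
      have := hlow hv y
      have := hupp hu y
      have := hupp hv y
      omega
  have h := Finset.card_le_card_of_injOn f (t := Finset.univ) (by simp) hf
  rwa [Finset.card_univ, Fintype.card_fun, Fintype.card_fin, Fintype.card_coe,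
    Finset.card_erase_of_mem hx] at h

theorem exists_ncard_eq_mldNum {G : SimpleGraph V} (hG : G.Connected) :
    ∃ S : Set V, Dominating G S ∧ Locating G S ∧ S.ncard = mldNum G := by
  refine Nat.sInf_mem (s := {k | ∃ S : Set V, Dominating G S ∧ Locating G S ∧ S.ncard = k})
    ⟨_, Set.univ, fun v hv => (hv trivial).elim, fun u v huv => ⟨u, trivial, ?_⟩, rfl⟩
  rw [SimpleGraph.dist_self]
  exact (hG.pos_dist_of_ne huv.symm).ne

theorem stmt2 [Fintype V] (G : SimpleGraph V) (hG : G.Connected) (hD : 3 ≤ G.diam) :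
    Fintype.card V ≤ mldNum G + mldNum G * 3 ^ (mldNum G - 1) := by
  classical
  obtain ⟨T, hdom, hloc, hcard⟩ := exists_ncard_eq_mldNum hG
  obtain ⟨S, rfl⟩ : ∃ S : Finset V, (S : Set V) = T := ⟨T.toFinset, by simp⟩
  rw [Set.ncard_coe_finset] at hcard
  rw [← hcard, ← Finset.card_add_card_compl S]
  refine Nat.add_le_add_left ?_ _
  have hsub : Sᶜ ⊆ S.biUnion fun x => Sᶜ.filter (G.Adj x) := by
    intro v hv
    obtain ⟨u, hu, huv⟩ := hdom v (by simpa using hv)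
    exact Finset.mem_biUnion.2 ⟨u, hu, Finset.mem_filter.2 ⟨hv, huv⟩⟩
  exact (Finset.card_le_card hsub).trans <|
    Finset.card_biUnion_le_card_mul _ _ _ fun x hx => hloc.card_neighbors_compl_le hG hx
end

section
/- Let G be a finite simple connected graph of order n and diameter D ≥ 3. Then λ(G) ≤ n − ⌈(3D−1)/5⌉; equivalently, λ(G) + ⌈(3D−1)/5⌉ ≤ n. -/
open SimpleGraph

variable {V : Type*}

/-- The vertices at positions `i` along a geodesic starting at `u` are at distance `i` from `u`. -/
lemma dist_getVert_of_length_eq_dist {G : SimpleGraph V} (hG : G.Connected) {u v : V}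
    (w : G.Walk u v) (hw : w.length = G.dist u v) {i : ℕ} (hi : i ≤ w.length) :
    G.dist u (w.getVert i) = i := by
  have h1 : G.dist u (w.getVert i) ≤ i :=
    (dist_le (w.take i)).trans (by simp [Walk.take_length])
  have h2 : G.dist (w.getVert i) v ≤ w.length - i :=
    (dist_le (w.drop i)).trans (by simp [Walk.drop_length])
  have h3 : G.dist u v ≤ G.dist u (w.getVert i) + G.dist (w.getVert i) v := hG.dist_triangle
  omega

/-- A vertex of index `i` on a geodesic is adjacent only to those of index `i - 1` and `i + 1`. -/
lemma adj_getVert_iff_of_length_eq_dist {G : SimpleGraph V} (hG : G.Connected) {u v : V}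
    (w : G.Walk u v) (hw : w.length = G.dist u v) {i j : ℕ} (hi : i ≤ w.length)
    (hj : j ≤ w.length) : G.Adj (w.getVert i) (w.getVert j) ↔ i + 1 = j ∨ j + 1 = i := by
  have di := dist_getVert_of_length_eq_dist hG w hw hi
  have dj := dist_getVert_of_length_eq_dist hG w hw hj
  constructor
  · intro h
    have h1 : G.dist u (w.getVert j) ≤ G.dist u (w.getVert i) + G.dist (w.getVert i) (w.getVert j) :=
      hG.dist_triangle
    have h2 : G.dist u (w.getVert i) ≤ G.dist u (w.getVert j) + G.dist (w.getVert j) (w.getVert i) :=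
      hG.dist_triangle
    rw [dist_eq_one_iff_adj.2 h] at h1
    rw [dist_eq_one_iff_adj.2 h.symm] at h2
    have hne : i ≠ j := by
      rintro rfl
      exact h.ne rfl
    omega
  · rintro (rfl | rfl)
    · exact w.adj_getVert_succ (by omega)
    · exact (w.adj_getVert_succ (by omega)).symm

/-- Positions outside an optimal locating-dominating set of the path on `0, …, d`. -/
def pathGaps (d : ℕ) : Set ℕ :=
  {i | i ≤ d ∧ (i % 5 = 0 ∨ i % 5 = 2 ∨ i % 5 = 4) ∧ (i = d → i % 5 = 4)}

lemma le_ncard_pathGaps (d : ℕ) : 3 * (d + 1) / 5 ≤ (pathGaps d).ncard := by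
  have hfin : (pathGaps d).Finite := (Set.finite_Iic d).subset fun i hi => hi.1
  have hmem : ∀ k ∈ Finset.range (3 * (d + 1) / 5), 5 * (k / 3) + 2 * (k % 3) ∈ hfin.toFinset := by
    intro k hk
    rw [Finset.mem_range] at hk
    rw [Set.Finite.mem_toFinset]
    obtain ⟨q, r, hr, rfl⟩ : ∃ q r, r < 3 ∧ k = 3 * q + r := ⟨k / 3, k % 3, by omega, by omega⟩
    rw [show (3 * q + r) / 3 = q by omega, show (3 * q + r) % 3 = r by omega]
    refine ⟨?_, ?_, ?_⟩ <;> interval_cases r <;> omega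
  rw [Set.ncard_eq_toFinset_card _ hfin]
  simpa using Finset.card_le_card_of_injOn (fun k => 5 * (k / 3) + 2 * (k % 3)) hmem
    (fun a _ b _ h => by dsimp only at h; omega)

/-- Removing the gap positions of a geodesic leaves a locating-dominating set. -/
lemma locatingDominating_compl_image_pathGaps {G : SimpleGraph V} (hG : G.Connected) {u v : V}
    (w : G.Walk u v) (hw : w.length = G.dist u v) :
    LocatingDominating G (w.getVert '' pathGaps w.length)ᶜ := by
  have hinj : ∀ {i j}, i ≤ w.length → j ≤ w.length → w.getVert i = w.getVert j → i = j := by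
    intro i j hi hj h
    rw [← dist_getVert_of_length_eq_dist hG w hw hi, h,
      dist_getVert_of_length_eq_dist hG w hw hj]
  have hadj := @adj_getVert_iff_of_length_eq_dist V G hG u v w hw
  have hS : ∀ k, k ≤ w.length → k ∉ pathGaps w.length →
      w.getVert k ∈ (w.getVert '' pathGaps w.length)ᶜ := by
    rintro k hk hkg ⟨l, hl, hlk⟩
    exact hkg (hinj hl.1 hk hlk ▸ hl)
  have hsep : ∀ i ∈ pathGaps w.length, ∀ j ∈ pathGaps w.length, i < j →
      G.neighborSet (w.getVert i) ∩ (w.getVert '' pathGaps w.length)ᶜ ≠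
        G.neighborSet (w.getVert j) ∩ (w.getVert '' pathGaps w.length)ᶜ := by
    intro i hi j hj hij h
    obtain ⟨k, hk, hkg, hiff⟩ : ∃ k ≤ w.length, k ∉ pathGaps w.length ∧
        ¬((i + 1 = k ∨ k + 1 = i) ↔ (j + 1 = k ∨ k + 1 = j)) := by
      simp only [pathGaps, Set.mem_ofPred_eq] at hi hj ⊢
      by_cases h0 : i % 5 = 0
      · by_cases h2 : j = i + 2
        · exact ⟨j + 1, by omega, by omega, by omega⟩
        · exact ⟨i + 1, by omega, by omega, by omega⟩
      · exact ⟨i - 1, by omega, by omega, by omega⟩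
    have := Set.ext_iff.1 h (w.getVert k)
    simp only [Set.mem_inter_iff, hS k hk hkg, and_true, mem_neighborSet, hadj hi.1 hk,
      hadj hj.1 hk] at this
    exact hiff this
  constructor
  · intro x hx
    obtain ⟨i, hi, rfl⟩ := not_not.1 hx
    obtain ⟨k, hk, hkg, hki⟩ : ∃ k ≤ w.length, k ∉ pathGaps w.length ∧
        (k + 1 = i ∨ i + 1 = k) := by
      simp only [pathGaps, Set.mem_ofPred_eq] at hi ⊢
      by_cases h0 : i % 5 = 0
      · exact ⟨i + 1, by omega, by omega, by omega⟩
      · exact ⟨i - 1, by omega, by omega, by omega⟩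
    exact ⟨_, hS k hk hkg, (hadj hk hi.1).2 hki⟩
  · intro x hx y hy hxy
    obtain ⟨i, hi, rfl⟩ := not_not.1 hx
    obtain ⟨j, hj, rfl⟩ := not_not.1 hy
    rcases lt_trichotomy i j with h | rfl | h
    · exact hsep i hi j hj h
    · exact absurd rfl hxy
    · exact (hsep j hj i hi h).symm

theorem stmt3 [Fintype V] (G : SimpleGraph V) (hG : G.Connected) (hD : 3 ≤ G.diam) :
    (locDomNum G : ℤ) + ⌈(3 * (G.diam : ℚ) - 1) / 5⌉ ≤ (Fintype.card V : ℤ) := by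
  have := hG.nonempty
  obtain ⟨u, v, huv⟩ := G.exists_dist_eq_diam
  obtain ⟨w, hw⟩ := hG.exists_walk_length_eq_dist u v
  have hinj : Set.InjOn w.getVert (pathGaps w.length) := by
    intro i hi j hj h
    rw [← dist_getVert_of_length_eq_dist hG w hw hi.1, h,
      dist_getVert_of_length_eq_dist hG w hw hj.1]
  have hlam : locDomNum G ≤ (w.getVert '' pathGaps w.length)ᶜ.ncard :=
    Nat.sInf_le ⟨_, locatingDominating_compl_image_pathGaps hG w hw, rfl⟩
  have hcard := Set.ncard_add_ncard_compl (w.getVert '' pathGaps w.length)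
  rw [hinj.ncard_image, Nat.card_eq_fintype_card] at hcard
  have hgaps := le_ncard_pathGaps w.length
  have hceil : ⌈(3 * (G.diam : ℚ) - 1) / 5⌉ ≤ ((pathGaps w.length).ncard : ℤ) := by
    rw [Int.ceil_le, div_le_iff₀ (by norm_num), sub_le_iff_le_add]
    have : 3 * G.diam ≤ (pathGaps w.length).ncard * 5 + 1 := by omega
    exact_mod_cast this
  omega
end

section
/- Let G be a finite simple connected graph of diameter 2. Then η(G) = λ(G). -/
open SimpleGraph

variable {V : Type*}

theorem SimpleGraph.Connected.dist_eq_two_of_not_adj {G : SimpleGraph V}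
    (hG : G.Connected) (hD : G.diam = 2) {u v : V} (hne : u ≠ v) (hadj : ¬ G.Adj u v) :
    G.dist u v = 2 := by
  have hle : G.dist u v ≤ G.diam :=
    dist_le_diam (ediam_ne_top_of_diam_ne_zero (by omega))
  have hpos := hG.pos_dist_of_ne hne
  have hone : G.dist u v ≠ 1 := fun h => hadj (dist_eq_one_iff_adj.mp h)
  omega

theorem SimpleGraph.Connected.dominating_and_locating_iff {G : SimpleGraph V}
    (hG : G.Connected) (hD : G.diam = 2) (S : Set V) :
    Dominating G S ∧ Locating G S ↔ LocatingDominating G S := by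
  refine and_congr_right fun _ => ⟨fun hloc u hu v hv huv hN => ?_, fun hnbr u v huv => ?_⟩
  · obtain ⟨x, hx, hdist⟩ := hloc u v huv
    have hiff : G.Adj u x ↔ G.Adj v x := by
      simpa [hx] using Set.ext_iff.mp hN x
    have hux : u ≠ x := fun h => hu (h ▸ hx)
    have hvx : v ≠ x := fun h => hv (h ▸ hx)
    by_cases ha : G.Adj u x
    · exact hdist (by rw [dist_eq_one_iff_adj.mpr ha, dist_eq_one_iff_adj.mpr (hiff.mp ha)])
    · exact hdist (by rw [hG.dist_eq_two_of_not_adj hD hux ha,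
        hG.dist_eq_two_of_not_adj hD hvx (mt hiff.mpr ha)])
  · by_cases hu : u ∈ S
    · exact ⟨u, hu, by simpa using (hG.pos_dist_of_ne huv.symm).ne⟩
    by_cases hv : v ∈ S
    · exact ⟨v, hv, by simpa using (hG.pos_dist_of_ne huv).ne'⟩
    by_contra! hall
    refine hnbr u hu v hv huv (Set.ext fun x => and_congr_left fun hx => ?_)
    simp only [mem_neighborSet, ← dist_eq_one_iff_adj, hall x hx]

theorem stmt5 [Fintype V] (G : SimpleGraph V) (hG : G.Connected) (hD : G.diam = 2) :
    mldNum G = locDomNum G := by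
  simp only [mldNum, locDomNum, ← and_assoc, hG.dominating_and_locating_iff hD]
end

section
/- Let G be a finite simple connected graph of order n with metric dimension β(G) ≥ n − 3. Then η(G) = λ(G). -/
open SimpleGraph

variable {V : Type*}

theorem SimpleGraph.Connected.exists_adj_dist_lt {G : SimpleGraph V} (hG : G.Connected)
    {u v : V} (h : u ≠ v) : ∃ w, G.Adj u w ∧ G.dist w v < G.dist u v := by
  obtain ⟨p, hp⟩ := hG.exists_walk_length_eq_dist u v
  cases p with
  | nil => exact absurd rfl h
  | cons hadj q =>
    refine ⟨_, hadj, ?_⟩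
    have := dist_le q
    rw [Walk.length_cons] at hp
    omega

theorem SimpleGraph.Connected.dist_le_dist_add_one_of_adj {G : SimpleGraph V} (hG : G.Connected)
    {u w : V} (h : G.Adj u w) (v : V) : G.dist u v ≤ G.dist w v + 1 := by
  have h₁ := hG.dist_triangle (u := u) (v := w) (w := v)
  have h₂ := dist_eq_one_iff_adj.2 h
  omega

theorem LocatingDominating.locating {G : SimpleGraph V} (hG : G.Connected) {D : Set V}
    (hD : LocatingDominating G D) : Locating G D := by
  intro u v huv
  by_contra! hdist
  by_cases hu : u ∈ D
  · have h := hdist u hu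
    rw [dist_self] at h
    exact huv (hG.dist_eq_zero_iff.1 h.symm).symm
  by_cases hv : v ∈ D
  · have h := hdist v hv
    rw [dist_self] at h
    exact huv (hG.dist_eq_zero_iff.1 h)
  refine hD.2 u hu v hv huv (Set.ext fun x => and_congr_left fun hx => ?_)
  rw [mem_neighborSet, mem_neighborSet, ← dist_eq_one_iff_adj, ← dist_eq_one_iff_adj, hdist x hx]

theorem locatingDominating_univ (G : SimpleGraph V) : LocatingDominating G Set.univ :=
  ⟨fun v hv => absurd (Set.mem_univ v) hv, fun u hu => absurd (Set.mem_univ u) hu⟩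

/-- A dominating set missing at most three vertices, together with two outside vertices `a`, `b`
with the same neighbors in it but located at different distances from `s`, can be exchanged for a
locating-dominating set of the same size. -/
theorem exists_locatingDominating_of_twins [Finite V] {G : SimpleGraph V} (hG : G.Connected)
    {S : Set V} (hS : Dominating G S) (hcard : Sᶜ.ncard ≤ 3) {a b s : V} (ha : a ∉ S) (hb : b ∉ S)
    (hab : ∀ x ∈ S, G.Adj a x ↔ G.Adj b x) (hs : s ∈ S) (hlt : G.dist a s < G.dist b s) :
    ∃ D : Set V, LocatingDominating G D ∧ D.ncard = S.ncard := by
  have hstep {u w : V} (h : G.Adj u w) := hG.dist_le_dist_add_one_of_adj h s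
  have hne_ab : a ≠ b := by rintro rfl; exact lt_irrefl _ hlt
  obtain ⟨c, hac, hc⟩ := hG.exists_adj_dist_lt (u := a) (v := s) (by rintro rfl; exact ha hs)
  have hbc : ¬ G.Adj b c := fun h => by have := hstep h; omega
  have hcS : c ∉ S := fun h => hbc ((hab c h).1 hac)
  have hne_bc : b ≠ c := by rintro rfl; omega
  obtain ⟨r, hcr, hr⟩ := hG.exists_adj_dist_lt (u := c) (v := s) (by rintro rfl; exact hcS hs)
  have hne_ar : a ≠ r := by rintro rfl; omega
  have hne_br : b ≠ r := by rintro rfl; omega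
  have hcompl : ({a, b, c} : Set V) = Sᶜ := by
    refine Set.eq_of_subset_of_ncard_le ?_ ?_ (Set.toFinite _)
    · rintro x (rfl | rfl | rfl) <;> assumption
    · rwa [Set.ncard_eq_three.2 ⟨a, b, c, hne_ab, hac.ne, hne_bc, rfl⟩]
  have hrS : r ∈ S := by
    by_contra h
    have : r ∈ ({a, b, c} : Set V) := hcompl ▸ h
    rcases this with h | h | h
    exacts [hne_ar h.symm, hne_br h.symm, hcr.ne h.symm]
  obtain ⟨t, htS, hta⟩ := hS a ha
  have htb : G.Adj b t := (hab t htS).1 hta.symm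
  have htr : ¬ G.Adj t r := fun h => by
    have := hstep h
    have := hstep htb
    omega
  have hbr : ¬ G.Adj b r := fun h => by have := hstep h; omega
  have htD : t ∈ ({a, b, r} : Set V)ᶜ := by
    rintro (h | h | h)
    exacts [ha (h ▸ htS), hb (h ▸ htS), hbr (h ▸ htb)]
  have hcD : c ∈ ({a, b, r} : Set V)ᶜ := by
    rintro (h | h | h)
    exacts [hac.ne h.symm, hne_bc h.symm, hcr.ne h]
  have key {u v x : V} (hx : x ∈ ({a, b, r} : Set V)ᶜ) (hu : G.Adj u x) (hv : ¬ G.Adj v x) :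
      G.neighborSet u ∩ {a, b, r}ᶜ ≠ G.neighborSet v ∩ {a, b, r}ᶜ := fun h =>
    hv (h.subset ⟨hu, hx⟩).1
  refine ⟨{a, b, r}ᶜ, ⟨fun v hv => ?_, fun u hu v hv huv => ?_⟩, ?_⟩
  · rcases Set.not_notMem.1 hv with rfl | rfl | rfl
    exacts [⟨t, htD, hta⟩, ⟨t, htD, htb.symm⟩, ⟨c, hcD, hcr⟩]
  · have hrt : ¬ G.Adj r t := fun h => htr h.symm
    rcases Set.not_notMem.1 hu with rfl | rfl | rfl <;>
      rcases Set.not_notMem.1 hv with rfl | rfl | rfl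
    exacts [absurd rfl huv, key hcD hac hbc, key htD hta.symm hrt,
      (key hcD hac hbc).symm, absurd rfl huv, key htD htb hrt,
      (key htD hta.symm hrt).symm, (key htD htb hrt).symm, absurd rfl huv]
  · have h₁ := Set.ncard_add_ncard_compl S
    have h₂ := Set.ncard_add_ncard_compl ({a, b, r} : Set V)
    rw [← hcompl, Set.ncard_eq_three.2 ⟨a, b, c, hne_ab, hac.ne, hne_bc, rfl⟩] at h₁
    rw [Set.ncard_eq_three.2 ⟨a, b, r, hne_ab, hne_ar, hne_br, rfl⟩] at h₂
    omega

theorem exists_locatingDominating_ncard_eq [Finite V] {G : SimpleGraph V} (hG : G.Connected)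
    {S : Set V} (hS : Dominating G S) (hloc : Locating G S) (hcard : Sᶜ.ncard ≤ 3) :
    ∃ D : Set V, LocatingDominating G D ∧ D.ncard = S.ncard := by
  by_cases hLD : LocatingDominating G S
  · exact ⟨S, hLD, rfl⟩
  obtain ⟨a, ha, b, hb, hne, heq⟩ : ∃ a ∉ S, ∃ b ∉ S, a ≠ b ∧
      G.neighborSet a ∩ S = G.neighborSet b ∩ S := by
    by_contra! h
    exact hLD ⟨hS, h⟩
  have hab : ∀ x ∈ S, G.Adj a x ↔ G.Adj b x := fun x hx =>
    ⟨fun h => (heq.subset ⟨h, hx⟩).1, fun h => (heq.symm.subset ⟨h, hx⟩).1⟩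
  obtain ⟨s, hs, hdist⟩ := hloc a b hne
  rcases lt_or_gt_of_ne hdist with hlt | hlt
  · exact exists_locatingDominating_of_twins hG hS hcard ha hb hab hs hlt
  · exact exists_locatingDominating_of_twins hG hS hcard hb ha (fun x hx => (hab x hx).symm) hs hlt

theorem stmt6 [Fintype V] (G : SimpleGraph V) (hG : G.Connected)
    (hβ : Fintype.card V - 3 ≤ metricDim G) :
    mldNum G = locDomNum G := by
  have huniv := locatingDominating_univ G
  obtain ⟨D, hD, hDcard⟩ : ∃ D : Set V, LocatingDominating G D ∧ D.ncard = locDomNum G :=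
    Nat.sInf_mem (s := {k | ∃ D : Set V, LocatingDominating G D ∧ D.ncard = k})
      ⟨_, Set.univ, huniv, rfl⟩
  obtain ⟨S, hS, hloc, hScard⟩ :
      ∃ S : Set V, Dominating G S ∧ Locating G S ∧ S.ncard = mldNum G :=
    Nat.sInf_mem (s := {k | ∃ S : Set V, Dominating G S ∧ Locating G S ∧ S.ncard = k})
      ⟨_, Set.univ, huniv.1, huniv.locating hG, rfl⟩
  have hle : metricDim G ≤ S.ncard := Nat.sInf_le ⟨S, hloc, rfl⟩
  have hadd := Set.ncard_add_ncard_compl S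
  rw [Nat.card_eq_fintype_card] at hadd
  obtain ⟨E, hE, hEcard⟩ := exists_locatingDominating_ncard_eq hG hS hloc (by omega)
  apply le_antisymm
  · exact Nat.sInf_le ⟨D, hD.1, hD.locating hG, hDcard⟩
  · exact Nat.sInf_le ⟨E, hE, hEcard.trans hScard⟩
end

section
/- Let G be a finite simple connected graph of order n with η(G) = 2. Then 3 ≤ n ≤ 8. -/
open SimpleGraph

variable {V : Type*}

lemma exists_dominating_locating_of_mldNum_ne_zero {G : SimpleGraph V} (h : mldNum G ≠ 0) :
    ∃ S : Set V, Dominating G S ∧ Locating G S ∧ S.ncard = mldNum G := by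
  have hne : {k | ∃ S : Set V, Dominating G S ∧ Locating G S ∧ S.ncard = k}.Nonempty := by
    by_contra hempty
    apply h
    rw [mldNum, Set.not_nonempty_iff_eq_empty.mp hempty, Nat.sInf_empty]
  exact Nat.sInf_mem hne

lemma mldNum_le_ncard {G : SimpleGraph V} {S : Set V} (hd : Dominating G S) (hl : Locating G S) :
    mldNum G ≤ S.ncard :=
  Nat.sInf_le ⟨S, hd, hl, rfl⟩

/-- A connected graph on at most two vertices is dominated and located by any vertex. -/
lemma mldNum_le_one_of_card_le_two [Fintype V] {G : SimpleGraph V} (hG : G.Connected)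
    (hcard : Fintype.card V ≤ 2) : mldNum G ≤ 1 := by
  classical
  obtain ⟨a⟩ := hG.nonempty
  have key : ∀ u v : V, u ≠ a → v ≠ a → u = v := by
    intro u v hu hv
    by_contra huv
    have h3 : ({u, v, a} : Finset V).card = 3 := Finset.card_eq_three.mpr
      ⟨u, v, a, huv, hu, hv, rfl⟩
    have := Finset.card_le_univ ({u, v, a} : Finset V)
    omega
  rw [← Set.ncard_singleton a]
  refine mldNum_le_ncard ?_ ?_
  · intro v hv
    refine ⟨a, rfl, ?_⟩
    obtain ⟨p⟩ := hG.preconnected a v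
    cases p with
    | nil => exact absurd rfl hv
    | cons h _ => exact key _ v h.ne' hv ▸ h
  · intro u v huv
    refine ⟨a, rfl, fun h => ?_⟩
    by_cases hu : u = a
    · subst hu
      rw [SimpleGraph.dist_self] at h
      exact huv ((hG.dist_eq_zero_iff).mp h.symm).symm
    · by_cases hv : v = a
      · subst hv
        rw [SimpleGraph.dist_self] at h
        exact huv (hG.dist_eq_zero_iff.mp h)
      · exact huv (key u v hu hv)

/-- A dominating locating pair leaves room for at most eight vectors of distances to it. -/
lemma card_le_eight_of_dominating_locating_pair [Fintype V] {G : SimpleGraph V}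
    (hG : G.Connected) {a b : V} (hd : Dominating G {a, b}) (hl : Locating G {a, b}) :
    Fintype.card V ≤ 8 := by
  classical
  let d := G.dist a b
  let T : Finset (ℕ × ℕ) :=
    {(0, d), (d, 0)} ∪ ({1} ×ˢ {d - 1, d, d + 1} ∪ {d - 1, d, d + 1} ×ˢ {1})
  have hthree : ({d - 1, d, d + 1} : Finset ℕ).card ≤ 3 := Finset.card_le_three
  have hT : T.card ≤ 8 := by
    refine (Finset.card_union_le _ _).trans
      ((Nat.add_le_add Finset.card_le_two (Finset.card_union_le _ _)).trans ?_)
    simp only [Finset.card_product, Finset.card_singleton]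
    omega
  refine le_trans ?_ hT
  rw [← Finset.card_univ]
  refine Finset.card_le_card_of_injOn (fun v => (G.dist v a, G.dist v b)) ?_ ?_
  · intro v _
    have h1 : G.dist a b ≤ G.dist v a + G.dist v b := by
      simpa only [G.dist_comm (u := a) (v := v)] using hG.dist_triangle (u := a) (v := v) (w := b)
    have h2 : G.dist v b ≤ G.dist v a + G.dist a b := hG.dist_triangle
    have h3 : G.dist v a ≤ G.dist v b + G.dist a b := by
      simpa only [G.dist_comm (u := b) (v := a)] using hG.dist_triangle (u := v) (v := b) (w := a)
    simp only [T, d, Finset.coe_union, Set.mem_union, Finset.mem_coe, Finset.mem_insert,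
      Finset.mem_singleton, Finset.mem_product, Prod.mk.injEq]
    by_cases hv : v ∈ ({a, b} : Set V)
    · rcases hv with rfl | rfl
      · simp
      · simp [G.dist_comm]
    · obtain ⟨u, rfl | rfl, huv⟩ := hd v hv
      · have := SimpleGraph.dist_eq_one_iff_adj.mpr huv.symm
        omega
      · have := SimpleGraph.dist_eq_one_iff_adj.mpr huv.symm
        omega
  · intro u _ v _ huv
    by_contra hne
    obtain ⟨x, rfl | rfl, hx⟩ := hl u v hne
    · exact hx (Prod.ext_iff.mp huv).1
    · exact hx (Prod.ext_iff.mp huv).2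

theorem stmt7 [Fintype V] (G : SimpleGraph V) (hG : G.Connected) (hη : mldNum G = 2) :
    3 ≤ Fintype.card V ∧ Fintype.card V ≤ 8 := by
  constructor
  · by_contra hcard
    have := mldNum_le_one_of_card_le_two hG (by omega)
    omega
  · obtain ⟨S, hd, hl, hS⟩ := exists_dominating_locating_of_mldNum_ne_zero (G := G) (by omega)
    obtain ⟨a, b, -, rfl⟩ := Set.ncard_eq_two.mp (hS.trans hη)
    exact card_le_eight_of_dominating_locating_pair hG hd hl
end

section
/- Let G be a finite simple connected graph with η(G) = 2. Then there exists an injective map f from the vertices of G to pairs (i,j) with 0 ≤ i,j ≤ 4 such that whenever x and y are adjacent in G, f(x) = (i,j) and f(y) = (i',j') satisfy |i − i'| ≤ 1 and |j − j'| ≤ 1; that is, G embeds injectively as a subgraph of the strong product P_5 ⊠ P_5 of two paths on 5 vertices. -/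
open SimpleGraph

variable {V : Type*}

/-- If `{a, b}` dominates a connected graph, then `a` and `b` are at distance at most three. -/
theorem Dominating.dist_le_three {G : SimpleGraph V} (hG : G.Connected) {a b : V}
    (hD : Dominating G {a, b}) : G.dist a b ≤ 3 := by
  by_contra! h
  obtain ⟨p, hp⟩ := hG.exists_walk_length_eq_dist a b
  have h₁ := dist_le (p.take 2)
  have h₂ := dist_le (p.drop 2)
  rw [Walk.take_length] at h₁
  rw [Walk.drop_length] at h₂
  have h₃ := hG.dist_triangle (u := a) (v := p.getVert 2) (w := b)
  have hv : p.getVert 2 ∉ ({a, b} : Set V) := by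
    rintro (h₀ | h₀) <;> rw [h₀] at h₁ h₂ h₃ <;> simp at h₁ h₂ h₃ <;> omega
  obtain ⟨u, rfl | rfl, hu⟩ := hD _ hv
  · have := dist_eq_one_iff_adj.mpr hu
    omega
  · have := dist_eq_one_iff_adj.mpr hu.symm
    omega

/-- If `{a, b}` dominates a connected graph, then every vertex is within distance four of `a`. -/
theorem Dominating.dist_lt_five {G : SimpleGraph V} (hG : G.Connected) {a b : V}
    (hD : Dominating G {a, b}) (v : V) : G.dist v a < 5 := by
  have hab := hD.dist_le_three hG
  rw [dist_comm] at hab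
  have htri := hG.dist_triangle (u := v) (v := b) (w := a)
  by_cases hv : v ∈ ({a, b} : Set V)
  · obtain rfl | rfl := hv
    · simp
    · omega
  · obtain ⟨u, rfl | rfl, hu⟩ := hD v hv <;>
      have := dist_eq_one_iff_adj.mpr hu.symm <;> omega

/-- The distances from two adjacent vertices to a third one differ by at most one. -/
theorem abs_dist_sub_dist_le_one {G : SimpleGraph V} (hG : G.Connected) {x y : V}
    (h : G.Adj x y) (a : V) : |(G.dist x a : ℤ) - (G.dist y a : ℤ)| ≤ 1 := by
  have h₁ := dist_eq_one_iff_adj.mpr h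
  have h₂ := dist_eq_one_iff_adj.mpr h.symm
  have h₃ := hG.dist_triangle (u := x) (v := y) (w := a)
  have h₄ := hG.dist_triangle (u := y) (v := x) (w := a)
  rw [abs_le]
  omega

theorem stmt9 [Fintype V] (G : SimpleGraph V) (hG : G.Connected) (hη : mldNum G = 2) :
    ∃ f : V → Fin 5 × Fin 5, Function.Injective f ∧
      ∀ x y : V, G.Adj x y →
        |((f x).1 : ℤ) - ((f y).1 : ℤ)| ≤ 1 ∧ |((f x).2 : ℤ) - ((f y).2 : ℤ)| ≤ 1 := by
  have hmem := Nat.sInf_mem (Nat.nonempty_of_pos_sInf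
    (show 0 < mldNum G by rw [hη]; exact two_pos))
  change ∃ S : Set V, Dominating G S ∧ Locating G S ∧ S.ncard = mldNum G at hmem
  rw [hη] at hmem
  obtain ⟨S, hD, hL, hS⟩ := hmem
  obtain ⟨a, b, -, rfl⟩ := Set.ncard_eq_two.mp hS
  have hD' : Dominating G {b, a} := by rwa [Set.pair_comm]
  refine ⟨fun v ↦ (⟨G.dist v a, hD.dist_lt_five hG v⟩, ⟨G.dist v b, hD'.dist_lt_five hG v⟩),
    fun u v huv ↦ ?_, fun x y h ↦
      ⟨abs_dist_sub_dist_le_one hG h a, abs_dist_sub_dist_le_one hG h b⟩⟩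
  simp only [Prod.mk.injEq, Fin.mk.injEq] at huv
  by_contra hne
  obtain ⟨x, rfl | rfl, hx⟩ := hL u v hne
  exacts [hx huv.1, hx huv.2]
end

section
/- Let G be a finite simple connected graph of order n with λ(G) ≥ n − 2. Then the diameter of G is at most 3. -/
open SimpleGraph

variable {V : Type*}

/-- On a path `a b c d e` whose ends are far enough apart, deleting `a`, `c` and `e`
leaves a locating-dominating set. -/
theorem locatingDominating_compl_of_path {G : SimpleGraph V} {a b c d e : V}
    (hab : G.Adj a b) (hbc : G.Adj b c) (hcd : G.Adj c d) (hde : G.Adj d e)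
    (had : ¬ G.Adj a d) (hbe : ¬ G.Adj b e) (hbe_ne : b ≠ e) (had_ne : a ≠ d) :
    LocatingDominating G ({a, c, e} : Set V)ᶜ := by
  have hb : b ∈ ({a, c, e} : Set V)ᶜ := by simp [hab.ne', hbc.ne, hbe_ne]
  have hd : d ∈ ({a, c, e} : Set V)ᶜ := by simp [had_ne.symm, hcd.ne', hde.ne]
  refine ⟨fun v hv => ?_, fun u hu v hv huv heq => ?_⟩
  · rw [Set.notMem_compl_iff] at hv
    rcases hv with rfl | rfl | rfl
    exacts [⟨b, hb, hab.symm⟩, ⟨b, hb, hbc⟩, ⟨d, hd, hde⟩]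
  · rw [Set.notMem_compl_iff] at hu hv
    have hb_iff : G.Adj u b ↔ G.Adj v b := by
      simpa [-Set.mem_compl_iff, hb] using Set.ext_iff.mp heq b
    have hd_iff : G.Adj u d ↔ G.Adj v d := by
      simpa [-Set.mem_compl_iff, hd] using Set.ext_iff.mp heq d
    have hbe' : ¬ G.Adj e b := fun h => hbe h.symm
    rcases hu with rfl | rfl | rfl <;> rcases hv with rfl | rfl | rfl <;>
      simp_all [hbc.symm]

theorem locDomNum_le_ncard {G : SimpleGraph V} {D : Set V} (hD : LocatingDominating G D) :
    locDomNum G ≤ D.ncard :=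
  Nat.sInf_le ⟨D, hD, rfl⟩

theorem stmt10 [Fintype V] (G : SimpleGraph V) (hG : G.Connected)
    (hl : Fintype.card V - 2 ≤ locDomNum G) :
    G.diam ≤ 3 := by
  by_contra! hdiam
  have := hG.nonempty
  obtain ⟨u, v, huv⟩ := G.exists_dist_eq_diam
  obtain ⟨p, hp⟩ := hG.exists_walk_length_eq_dist u v
  rw [← huv, ← hp] at hdiam
  match p, hp, hdiam with
  | .cons (v := b) hab (.cons (v := c) hbc (.cons (v := d) hcd (.cons (v := e) hde q))), hp, _ =>
    simp only [Walk.length_cons] at hp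
    have had : ¬ G.Adj u d := fun h => by
      have := dist_le (.cons h (.cons hde q))
      simp only [Walk.length_cons] at this
      omega
    have hbe : ¬ G.Adj b e := fun h => by
      have := dist_le (.cons hab (.cons h q))
      simp only [Walk.length_cons] at this
      omega
    have hbe_ne : b ≠ e := by
      rintro rfl
      have := dist_le (.cons hab q)
      simp only [Walk.length_cons] at this
      omega
    have had_ne : u ≠ d := by
      rintro rfl
      have := dist_le (.cons hde q)
      simp only [Walk.length_cons] at this
      omega
    have hle := locDomNum_le_ncard
      (locatingDominating_compl_of_path hab hbc hcd hde had hbe hbe_ne had_ne)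
    have hcard : ({u, c, e} : Set V).ncard = 3 :=
      Set.ncard_eq_three.mpr ⟨u, c, e, fun h => had (h ▸ hcd), fun h => hbe (h ▸ hab.symm),
        fun h => hbe (h ▸ hbc), rfl⟩
    have hsum := Set.ncard_add_ncard_compl ({u, c, e} : Set V)
    rw [Nat.card_eq_fintype_card] at hsum
    have hpos : 0 < (({u, c, e} : Set V)ᶜ).ncard :=
      (Set.ncard_pos).mpr ⟨b, by simp [hab.ne', hbc.ne, hbe_ne]⟩
    omega
end

section
/- Let G be a finite simple connected graph of order n with η(G) = n − 3. Then λ(G) = n − 3. -/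
open SimpleGraph

variable {V : Type*}

theorem SimpleGraph.Connected.exists_adj_dist_add_one_eq {G : SimpleGraph V} (hG : G.Connected)
    {v x : V} (h : v ≠ x) : ∃ z, G.Adj v z ∧ G.dist z x + 1 = G.dist v x := by
  obtain ⟨p, hp⟩ := hG.exists_walk_length_eq_dist v x
  cases p with
  | nil => exact absurd rfl h
  | cons hadj q =>
    rename_i z
    refine ⟨z, hadj, ?_⟩
    have h₁ := dist_le q
    have h₂ := hG.dist_triangle (u := v) (v := z) (w := x)
    rw [dist_eq_one_iff_adj.mpr hadj] at h₂
    rw [Walk.length_cons] at hp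
    omega

theorem SimpleGraph.Connected.dist_le_add_one_of_adj {G : SimpleGraph V} (hG : G.Connected)
    {u v : V} (h : G.Adj u v) (x : V) : G.dist u x ≤ G.dist v x + 1 := by
  have := hG.dist_triangle (u := u) (v := v) (w := x)
  rw [dist_eq_one_iff_adj.mpr h] at this
  omega

theorem mldNum_le_locDomNum {G : SimpleGraph V} (hG : G.Connected) : mldNum G ≤ locDomNum G := by
  have hne : {k | ∃ D : Set V, LocatingDominating G D ∧ D.ncard = k}.Nonempty :=
    ⟨_, Set.univ, ⟨fun v hv => absurd trivial hv, fun u hu => absurd trivial hu⟩, rfl⟩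
  obtain ⟨D, hD, hcard⟩ := Nat.sInf_mem hne
  exact Nat.sInf_le ⟨D, hD.1, hD.locating hG, hcard⟩

/-- Given a path `b u a c y`, possibly with additional edges other than `b c` and `u y`,
the vertices `u` and `c` locate and dominate `a`, `b` and `y`. -/
theorem locatingDominating_compl_triple {G : SimpleGraph V} {a b c u y : V}
    (hau : G.Adj a u) (hbu : G.Adj b u) (hac : G.Adj a c) (hyc : G.Adj y c)
    (hbc : ¬ G.Adj b c) (hyu : ¬ G.Adj y u) (hcb : c ≠ b) (huy : u ≠ y) :
    LocatingDominating G ({a, b, y}ᶜ : Set V) := by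
  have hu : u ∈ ({a, b, y}ᶜ : Set V) := by
    simp [hau.ne', hbu.ne', huy]
  have hc : c ∈ ({a, b, y}ᶜ : Set V) := by
    simp [hac.ne', hyc.ne', hcb]
  have hmem : ∀ {v}, v ∉ ({a, b, y}ᶜ : Set V) → v = a ∨ v = b ∨ v = y :=
    fun hv => Set.notMem_compl_iff.mp hv
  constructor
  · intro v hv
    rcases hmem hv with rfl | rfl | rfl
    · exact ⟨u, hu, hau.symm⟩
    · exact ⟨u, hu, hbu.symm⟩
    · exact ⟨c, hc, hyc.symm⟩
  · intro v hv w hw hvw h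
    have h₁ : G.Adj v u ↔ G.Adj w u := by simpa only [Set.mem_inter_iff, hu, and_true,
      mem_neighborSet] using Set.ext_iff.mp h u
    have h₂ : G.Adj v c ↔ G.Adj w c := by simpa only [Set.mem_inter_iff, hc, and_true,
      mem_neighborSet] using Set.ext_iff.mp h c
    rcases hmem hv with rfl | rfl | rfl <;> rcases hmem hw with rfl | rfl | rfl <;> tauto

/-- If two vertices outside a dominating set have the same neighbors in it, but one of them is
closer to some vertex of the set, then these two and a suitable third vertex can be omitted from a
locating-dominating set. -/
theorem exists_locatingDominating_compl_triple {G : SimpleGraph V} (hG : G.Connected)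
    {S : Set V} (hS : Dominating G S) {a b c x : V} (hSc : Sᶜ = {a, b, c})
    (hN : G.neighborSet a ∩ S = G.neighborSet b ∩ S) (hx : x ∈ S)
    (hlt : G.dist a x < G.dist b x) :
    ∃ y, y ≠ a ∧ y ≠ b ∧ LocatingDominating G ({a, b, y}ᶜ : Set V) := by
  have hmem : ∀ v, v ∉ S ↔ v = a ∨ v = b ∨ v = c := fun v => Set.ext_iff.mp hSc v
  have hN' : ∀ v ∈ S, (G.Adj a v ↔ G.Adj b v) := fun v hv => by
    simpa [hv] using Set.ext_iff.mp hN v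
  have hdist := fun {p q : V} (h : G.Adj p q) => hG.dist_le_add_one_of_adj h x
  have haS : a ∉ S := (hmem a).2 (.inl rfl)
  have hbS : b ∉ S := (hmem b).2 (.inr (.inl rfl))
  have hcS : c ∉ S := (hmem c).2 (.inr (.inr rfl))
  obtain ⟨z, haz, hz⟩ := hG.exists_adj_dist_add_one_eq (v := a) (x := x) (by grind)
  have hzS : z ∉ S := fun h => by
    have := hdist ((hN' z h).1 haz)
    omega
  obtain rfl : z = c := by
    rcases (hmem z).1 hzS with rfl | rfl | h
    · exact absurd haz (G.irrefl)
    · omega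
    · exact h
  obtain ⟨y, hzy, hy⟩ := hG.exists_adj_dist_add_one_eq (v := z) (x := x) (by grind)
  have hya : y ≠ a := by rintro rfl; omega
  have hyb : y ≠ b := by rintro rfl; omega
  obtain ⟨u, huS, hub⟩ := hS b hbS
  refine ⟨y, hya, hyb, locatingDominating_compl_triple ((hN' u huS).2 hub.symm) hub.symm haz
    hzy.symm (fun h => ?_) (fun h => ?_) ?_ ?_⟩
  · have := hdist h
    omega
  · have h₁ := hdist h.symm
    have h₂ := hdist hub.symm
    omega
  · rintro rfl
    omega
  · rintro rfl
    have := hdist hub.symm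
    omega

theorem locDomNum_le_of_compl_triple [Fintype V] {G : SimpleGraph V} {a b y : V} (hab : a ≠ b)
    (hya : y ≠ a) (hyb : y ≠ b) (h : LocatingDominating G ({a, b, y}ᶜ : Set V)) :
    locDomNum G ≤ Fintype.card V - 3 := by
  refine Nat.sInf_le ⟨_, h, ?_⟩
  rw [Set.ncard_compl, Nat.card_eq_fintype_card,
    Set.ncard_eq_three.mpr ⟨a, b, y, hab, hya.symm, hyb.symm, rfl⟩]

/-- A set of three vertices containing two given ones. -/
theorem Set.exists_eq_triple_of_ncard_eq_three {T : Set V} (hT : T.ncard = 3) {a b : V}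
    (ha : a ∈ T) (hb : b ∈ T) (hab : a ≠ b) : ∃ c, T = {a, b, c} := by
  have hsub : {a, b} ⊆ T := Set.pair_subset ha hb
  obtain ⟨c, hc⟩ := Set.ncard_eq_one.mp <| show (T \ {a, b}).ncard = 1 by
    rw [Set.ncard_sdiff hsub, hT, Set.ncard_pair hab]
  refine ⟨c, ?_⟩
  rw [← Set.sdiff_union_of_subset hsub, hc, Set.singleton_union, Set.insert_comm c a,
    Set.pair_comm c b]

theorem locDomNum_le_of_locating [Fintype V] {G : SimpleGraph V} (hG : G.Connected) {S : Set V}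
    (hS : Dominating G S) (hL : Locating G S) (hcard : S.ncard = Fintype.card V - 3) :
    locDomNum G ≤ Fintype.card V - 3 := by
  have hpos : 0 < S.ncard := by
    rw [Set.ncard_pos]
    obtain ⟨v⟩ := hG.nonempty
    by_cases hv : v ∈ S
    · exact ⟨v, hv⟩
    · obtain ⟨u, hu, -⟩ := hS v hv
      exact ⟨u, hu⟩
  have hT : Sᶜ.ncard = 3 := by
    rw [Set.ncard_compl, Nat.card_eq_fintype_card]
    omega
  by_cases hLD : LocatingDominating G S
  · exact Nat.sInf_le ⟨S, hLD, hcard⟩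
  obtain ⟨a, ha, b, hb, hab, hN⟩ : ∃ a ∉ S, ∃ b ∉ S, a ≠ b ∧
      G.neighborSet a ∩ S = G.neighborSet b ∩ S := by
    by_contra! h
    exact hLD ⟨hS, h⟩
  obtain ⟨x, hx, hne⟩ := hL a b hab
  rcases lt_or_gt_of_ne hne with hlt | hlt
  · obtain ⟨c, hc⟩ := Set.exists_eq_triple_of_ncard_eq_three hT ha hb hab
    obtain ⟨y, hya, hyb, h⟩ := exists_locatingDominating_compl_triple hG hS hc hN hx hlt
    exact locDomNum_le_of_compl_triple hab hya hyb h
  · obtain ⟨c, hc⟩ := Set.exists_eq_triple_of_ncard_eq_three hT hb ha hab.symm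
    obtain ⟨y, hyb, hya, h⟩ := exists_locatingDominating_compl_triple hG hS hc hN.symm hx hlt
    exact locDomNum_le_of_compl_triple hab.symm hyb hya h

theorem stmt12 [Fintype V] (G : SimpleGraph V) (hG : G.Connected)
    (hη : mldNum G = Fintype.card V - 3) :
    locDomNum G = Fintype.card V - 3 := by
  refine le_antisymm ?_ (hη ▸ mldNum_le_locDomNum hG)
  have hne : {k | ∃ S : Set V, Dominating G S ∧ Locating G S ∧ S.ncard = k}.Nonempty := by
    refine ⟨_, Set.univ, fun v hv => absurd trivial hv, fun u v huv => ⟨u, trivial, fun h => huv ?_⟩,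
      rfl⟩
    rw [dist_self] at h
    exact (hG.dist_eq_zero_iff.mp h.symm).symm
  obtain ⟨S, hS, hL, hcard⟩ := Nat.sInf_mem hne
  exact locDomNum_le_of_locating hG hS hL (hcard.trans hη)
end

section
/- For all positive integers a, b, c with max{a, b} ≤ c ≤ a + b, and not satisfying (b = 1 and 1 < a and c = a + 1), there exists a finite simple connected graph G with γ(G) = a, β(G) = b and η(G) = c. -/
open SimpleGraph

variable {V : Type*}

/-- The graph on `V` in which vertices on consecutive levels of `pos` are adjacent, and the
vertices on level `p` form a clique if `C p` and an independent set otherwise. -/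
def layerGraph (pos : V → ℕ) (C : ℕ → Prop) : SimpleGraph V where
  Adj u v := u ≠ v ∧ (pos u = pos v ∧ C (pos u) ∨ pos u + 1 = pos v ∨ pos v + 1 = pos u)
  symm := ⟨by
    rintro u v ⟨h, h'⟩
    refine ⟨h.symm, ?_⟩
    rcases h' with ⟨h1, h2⟩ | h1 | h1
    · exact Or.inl ⟨h1.symm, h1 ▸ h2⟩
    · exact Or.inr (Or.inr h1)
    · exact Or.inr (Or.inl h1)⟩
  loopless := ⟨fun _ h => h.1 rfl⟩

/-- The levels of `pos` are exactly `0, …, L - 1`, and equal-level vertices are at distance at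
most two in `layerGraph pos C`. -/
structure IsLayering (pos : V → ℕ) (C : ℕ → Prop) (L : ℕ) : Prop where
  lt : ∀ v, pos v < L
  surj : ∀ p < L, ∃ v, pos v = p
  two_le_or : 2 ≤ L ∨ ∀ p, C p
  pos_length : 0 < L

section Distances

variable {pos : V → ℕ} {C : ℕ → Prop} {L : ℕ}

theorem layerGraph_adj_of_succ {u v : V} (h : pos u + 1 = pos v) :
    (layerGraph pos C).Adj u v :=
  ⟨by rintro rfl; omega, Or.inr (Or.inl h)⟩

theorem IsLayering.exists_walk (h : IsLayering pos C L) (d : ℕ) (u v : V)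
    (huv : pos u + (d + 1) = pos v) :
    ∃ w : (layerGraph pos C).Walk u v, w.length = d + 1 := by
  induction d generalizing u with
  | zero => exact ⟨(layerGraph_adj_of_succ huv).toWalk, rfl⟩
  | succ d ih =>
    obtain ⟨x, hx⟩ := h.surj (pos u + 1) (by have := h.lt v; omega)
    obtain ⟨w, hw⟩ := ih x (by omega)
    exact ⟨.cons (layerGraph_adj_of_succ hx.symm) w, by simp [hw]⟩

theorem layerGraph_pos_le_add_length {u v : V} (w : (layerGraph pos C).Walk u v) :
    pos v ≤ pos u + w.length := by
  induction w with
  | nil => simp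
  | cons h w ih =>
    rw [Walk.length_cons]
    have := h.2
    omega

theorem IsLayering.exists_walk_of_pos_eq (h : IsLayering pos C L) {u v : V}
    (huv : pos u = pos v) (hC : ¬ C (pos u)) :
    ∃ w : (layerGraph pos C).Walk u v, w.length = 2 := by
  have hL : 2 ≤ L := h.two_le_or.resolve_right fun hp => hC (hp _)
  have hu := h.lt u
  by_cases h0 : pos u = 0
  · obtain ⟨x, hx⟩ := h.surj 1 (by omega)
    exact ⟨.cons (layerGraph_adj_of_succ (by omega))
      (layerGraph_adj_of_succ (u := v) (v := x) (by omega)).symm.toWalk, rfl⟩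
  · obtain ⟨x, hx⟩ := h.surj (pos u - 1) (by omega)
    exact ⟨.cons (layerGraph_adj_of_succ (u := x) (v := u) (by omega)).symm
      (layerGraph_adj_of_succ (by omega)).toWalk, rfl⟩

theorem IsLayering.connected (h : IsLayering pos C L) : (layerGraph pos C).Connected := by
  obtain ⟨v₀, -⟩ := h.surj 0 h.pos_length
  have : Nonempty V := ⟨v₀⟩
  refine ⟨fun u v => ?_⟩
  rcases lt_trichotomy (pos u) (pos v) with huv | huv | huv
  · obtain ⟨w, -⟩ := h.exists_walk (pos v - pos u - 1) u v (by omega)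
    exact ⟨w⟩
  · by_cases hne : u = v
    · exact hne ▸ Reachable.refl _
    by_cases hC : C (pos u)
    · exact Adj.reachable ⟨hne, Or.inl ⟨huv, hC⟩⟩
    · obtain ⟨w, -⟩ := h.exists_walk_of_pos_eq huv hC
      exact ⟨w⟩
  · obtain ⟨w, -⟩ := h.exists_walk (pos u - pos v - 1) v u (by omega)
    exact ⟨w.reverse⟩

theorem IsLayering.dist_of_lt (h : IsLayering pos C L) {u v : V} (huv : pos u < pos v) :
    (layerGraph pos C).dist u v = pos v - pos u := by
  obtain ⟨w, hw⟩ := h.exists_walk (pos v - pos u - 1) u v (by omega)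
  obtain ⟨w', hw'⟩ := h.connected.exists_walk_length_eq_dist u v
  have h1 := dist_le w
  have h2 := layerGraph_pos_le_add_length w'
  omega

open Classical in
theorem IsLayering.dist_of_pos_eq (h : IsLayering pos C L) {u v : V} (hne : u ≠ v)
    (huv : pos u = pos v) :
    (layerGraph pos C).dist u v = if C (pos u) then 1 else 2 := by
  split_ifs with hC
  · exact dist_eq_one_iff_adj.2 ⟨hne, Or.inl ⟨huv, hC⟩⟩
  · obtain ⟨w, hw⟩ := h.exists_walk_of_pos_eq huv hC
    have h1 := dist_le w
    have h2 := h.connected.pos_dist_of_ne hne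
    have h3 : (layerGraph pos C).dist u v ≠ 1 := fun h3 => by
      have h4 := (dist_eq_one_iff_adj.1 h3).2
      rcases h4 with h4 | h4 | h4
      · exact hC h4.2
      · omega
      · omega
    omega

theorem IsLayering.injOn_compl_of_locating (h : IsLayering pos C L) {S : Set V}
    (hS : Locating (layerGraph pos C) S) : Set.InjOn pos Sᶜ := by
  intro u hu v hv huv
  by_contra hne
  obtain ⟨x, hx, hd⟩ := hS u v hne
  have hux : u ≠ x := fun e => hu (e ▸ hx)
  have hvx : v ≠ x := fun e => hv (e ▸ hx)
  rcases lt_trichotomy (pos u) (pos x) with h1 | h1 | h1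
  · rw [h.dist_of_lt h1, h.dist_of_lt (huv ▸ h1), huv] at hd
    exact hd rfl
  · rw [h.dist_of_pos_eq hux h1, h.dist_of_pos_eq hvx (huv ▸ h1), huv] at hd
    exact hd rfl
  · rw [dist_comm, h.dist_of_lt h1, dist_comm, h.dist_of_lt (huv ▸ h1), huv] at hd
    exact hd rfl

theorem IsLayering.locating_of_injOn (h : IsLayering pos C L) {S : Set V}
    (hS : Set.InjOn pos Sᶜ)
    (hsep : ∀ u ∉ S, ∀ v ∉ S, pos u < pos v →
      ∃ x ∈ S, (layerGraph pos C).dist u x ≠ (layerGraph pos C).dist v x) :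
    Locating (layerGraph pos C) S := by
  intro u v hne
  by_cases hu : u ∈ S
  · refine ⟨u, hu, ?_⟩
    rw [dist_self]
    exact (h.connected.pos_dist_of_ne hne.symm).ne
  by_cases hv : v ∈ S
  · refine ⟨v, hv, ?_⟩
    rw [dist_self]
    exact (h.connected.pos_dist_of_ne hne).ne'
  rcases lt_trichotomy (pos u) (pos v) with huv | huv | huv
  · exact hsep u hu v hv huv
  · exact absurd (hS hu hv huv) hne
  · obtain ⟨x, hx, hd⟩ := hsep v hv u hu huv
    exact ⟨x, hx, hd.symm⟩

theorem IsLayering.dist_cases (h : IsLayering pos C L) {u v : V} (hne : u ≠ v) :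
    (layerGraph pos C).dist u v + pos u = pos v ∧ pos u < pos v ∨
    (layerGraph pos C).dist u v + pos v = pos u ∧ pos v < pos u ∨
    pos u = pos v ∧ 1 ≤ (layerGraph pos C).dist u v ∧ (layerGraph pos C).dist u v ≤ 2 := by
  rcases lt_trichotomy (pos u) (pos v) with h1 | h1 | h1
  · have := h.dist_of_lt h1
    omega
  · have := h.dist_of_pos_eq hne h1
    split_ifs at this <;> omega
  · have := h.dist_of_lt h1
    rw [dist_comm] at this
    omega

theorem IsLayering.locating_of_far (h : IsLayering pos C L) {S : Set V}
    (hS : Set.InjOn pos Sᶜ) {s t : V} (hs : s ∈ S) (ht : t ∈ S) (hst : pos s + 3 ≤ pos t) :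
    Locating (layerGraph pos C) S := by
  refine h.locating_of_injOn hS fun u hu v hv huv => ?_
  by_contra! hcon
  have e1 := hcon s hs
  have e2 := hcon t ht
  have d1 := h.dist_cases (u := u) (v := s) (fun e => hu (e ▸ hs))
  have d2 := h.dist_cases (u := u) (v := t) (fun e => hu (e ▸ ht))
  have d3 := h.dist_cases (u := v) (v := s) (fun e => hv (e ▸ hs))
  have d4 := h.dist_cases (u := v) (v := t) (fun e => hv (e ▸ ht))
  omega

theorem IsLayering.card_le_of_locating [Finite V] (h : IsLayering pos C L) {S : Set V}
    (hS : Locating (layerGraph pos C) S) : Nat.card V ≤ S.ncard + L := by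
  have h1 := Set.ncard_le_ncard_of_injOn (s := Sᶜ) (t := (Finset.range L : Set ℕ)) pos
    (fun v _ => by simpa using h.lt v) (h.injOn_compl_of_locating hS) (Finset.finite_toSet _)
  rw [Set.ncard_coe_finset, Finset.card_range] at h1
  have h2 := Set.ncard_add_ncard_compl S
  omega

end Distances

section Blocks

variable {pos : V → ℕ} {a : ℕ}

theorem le_ncard_of_dominating_blocks [Finite V]
    (h : IsLayering pos (fun p => p % 3 = 1) (3 * a)) {D : Set V}
    (hD : Dominating (layerGraph pos fun p => p % 3 = 1) D) : a ≤ D.ncard := by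
  have h1 : (Finset.range a : Set ℕ) ⊆ (fun v => pos v / 3) '' D := by
    intro i hi
    obtain ⟨v, hv⟩ := h.surj (3 * i + 1) (by simp at hi; omega)
    by_cases hvD : v ∈ D
    · exact ⟨v, hvD, by simp only; omega⟩
    · obtain ⟨u, hu, huv⟩ := hD v hvD
      have := huv.2
      exact ⟨u, hu, by simp only; omega⟩
  have h2 := Set.ncard_le_ncard h1 (Set.toFinite _)
  rw [Set.ncard_coe_finset, Finset.card_range] at h2
  exact h2.trans (Set.ncard_image_le (Set.toFinite _))

theorem exists_level_subset
    (h : IsLayering pos (fun p => p % 3 = 1) (3 * a))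
    (hsub : ∀ u v, pos u = pos v → pos u % 3 ≠ 1 → pos u ≠ 0 → pos u + 1 ≠ 3 * a → u = v)
    {S : Set V} (hS : Dominating (layerGraph pos fun p => p % 3 = 1) S)
    {i : ℕ} (hc : ∀ u v, pos u = 3 * i + 1 → pos v = 3 * i + 1 → u = v) :
    ∃ p, p / 3 = i ∧ ∀ v, pos v = p → v ∈ S := by
  by_contra! hcon
  obtain ⟨u, hu, huS⟩ := hcon (3 * i) (by omega)
  obtain ⟨v, hv, hvS⟩ := hcon (3 * i + 1) (by omega)
  obtain ⟨w, hw, hwS⟩ := hcon (3 * i + 2) (by omega)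
  obtain ⟨x, hx, hxu⟩ := hS u huS
  obtain ⟨y, hy, hyv⟩ := hS v hvS
  obtain ⟨z, hz, hzw⟩ := hS w hwS
  have hcx : pos x ≠ 3 * i + 1 := fun e => hvS (hc x v e hv ▸ hx)
  have hcy : pos y ≠ 3 * i + 1 := fun e => hvS (hc y v e hv ▸ hy)
  have hcz : pos z ≠ 3 * i + 1 := fun e => hvS (hc z v e hv ▸ hz)
  have hlt := h.lt z
  have h1 := hxu.2
  have h2 := hyv.2
  have h3 := hzw.2
  have hyu : pos y = pos u → i = 0 := fun e => by
    by_contra h0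
    exact huS (hsub y u e (by omega) (by omega) (by omega) ▸ hy)
  have hyw : pos y = pos w → i + 1 = a := fun e => by
    by_contra h0
    exact hwS (hsub y w e (by omega) (by omega) (by omega) ▸ hy)
  omega

theorem card_add_card_le_of_dominating_locating [Finite V]
    (h : IsLayering pos (fun p => p % 3 = 1) (3 * a))
    (hsub : ∀ u v, pos u = pos v → pos u % 3 ≠ 1 → pos u ≠ 0 → pos u + 1 ≠ 3 * a → u = v)
    {S : Set V} (hD : Dominating (layerGraph pos fun p => p % 3 = 1) S)
    (hS : Locating (layerGraph pos fun p => p % 3 = 1) S) (B : Finset ℕ)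
    (hB : ∀ i ∈ B, i < a ∧ ∀ u v, pos u = 3 * i + 1 → pos v = 3 * i + 1 → u = v) :
    Nat.card V + B.card ≤ S.ncard + 3 * a := by
  have key : ∀ i, ∃ p, i ∈ B → p / 3 = i ∧ ∀ v, pos v = p → v ∈ S := fun i => by
    by_cases hi : i ∈ B
    · obtain ⟨p, hp⟩ := exists_level_subset h hsub hD (hB i hi).2
      exact ⟨p, fun _ => hp⟩
    · exact ⟨0, fun h => absurd h hi⟩
  choose f hf using key
  have hinj : Set.InjOn f B := fun i hi j hj hij => by
    rw [← (hf i hi).1, ← (hf j hj).1, hij]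
  have hsubset : B.image f ⊆ Finset.range (3 * a) := by
    intro p hp
    obtain ⟨i, hi, rfl⟩ := Finset.mem_image.1 hp
    have h1 := (hf i hi).1
    have h2 := (hB i hi).1
    exact Finset.mem_range.2 (by omega)
  have h1 := Set.ncard_le_ncard_of_injOn (s := Sᶜ)
    (t := ((Finset.range (3 * a) \ B.image f : Finset ℕ) : Set ℕ)) pos
    (fun v hv => by
      rw [Finset.mem_coe, Finset.mem_sdiff, Finset.mem_range]
      refine ⟨h.lt v, fun hp => ?_⟩
      obtain ⟨i, hi, hip⟩ := Finset.mem_image.1 hp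
      exact hv ((hf i hi).2 v hip.symm))
    (h.injOn_compl_of_locating hS) (Finset.finite_toSet _)
  have h3 := Finset.card_le_card hsubset
  rw [Set.ncard_coe_finset, Finset.card_sdiff_of_subset hsubset] at h1
  rw [Finset.card_image_of_injOn hinj, Finset.card_range] at h1 h3
  have h2 := Set.ncard_add_ncard_compl S
  omega

end Blocks

theorem sInf_ncard_eq {P : Set V → Prop} {k : ℕ} (S : Set V) (hS : P S) (hk : S.ncard ≤ k)
    (hmin : ∀ T, P T → k ≤ T.ncard) : sInf {n | ∃ T, P T ∧ T.ncard = n} = k := by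
  refine IsLeast.csInf_eq ⟨⟨S, hS, le_antisymm hk (hmin S hS)⟩, ?_⟩
  rintro n ⟨T, hT, rfl⟩
  exact hmin T hT

theorem domNum_eq {G : SimpleGraph V} {k : ℕ} (S : Set V) (hS : Dominating G S)
    (hk : S.ncard ≤ k) (hmin : ∀ T, Dominating G T → k ≤ T.ncard) : domNum G = k :=
  sInf_ncard_eq S hS hk hmin

theorem metricDim_eq {G : SimpleGraph V} {k : ℕ} (S : Set V) (hS : Locating G S)
    (hk : S.ncard ≤ k) (hmin : ∀ T, Locating G T → k ≤ T.ncard) : metricDim G = k :=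
  sInf_ncard_eq S hS hk hmin

theorem mldNum_eq {G : SimpleGraph V} {k : ℕ} (S : Set V) (hD : Dominating G S)
    (hS : Locating G S) (hk : S.ncard ≤ k)
    (hmin : ∀ T, Dominating G T → Locating G T → k ≤ T.ncard) : mldNum G = k := by
  have := sInf_ncard_eq (P := fun T => Dominating G T ∧ Locating G T) S ⟨hD, hS⟩ hk
    fun T hT => hmin T hT.1 hT.2
  simp only [and_assoc] at this
  exact this

theorem ncard_le_card_of_val_mem {n : ℕ} {S : Set (Fin n)} (T : Finset ℕ)
    (h : ∀ v ∈ S, v.val ∈ T) : S.ncard ≤ T.card := by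
  rw [← Set.ncard_coe_finset]
  exact Set.ncard_le_ncard_of_injOn Fin.val h Fin.val_injective.injOn (Finset.finite_toSet _)

theorem one_le_ncard_of_dominating [Finite V] [Nonempty V] {G : SimpleGraph V} {D : Set V}
    (hD : Dominating G D) : 1 ≤ D.ncard := by
  rw [Nat.one_le_iff_ne_zero, ne_eq, Set.ncard_eq_zero]
  rintro rfl
  obtain ⟨v⟩ := ‹Nonempty V›
  obtain ⟨u, hu, -⟩ := hD v (Set.notMem_empty v)
  exact hu

theorem one_le_ncard_of_locating [Finite V] [Nontrivial V] {G : SimpleGraph V} {S : Set V}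
    (hS : Locating G S) : 1 ≤ S.ncard := by
  rw [Nat.one_le_iff_ne_zero, ne_eq, Set.ncard_eq_zero]
  rintro rfl
  obtain ⟨u, v, huv⟩ := exists_pair_ne V
  obtain ⟨x, hx, -⟩ := hS u v huv
  exact hx

/-- Levels for the path on `0, …, L - 1` with `x` further vertices, the `j`-th of which is a copy
of the path vertex `e j`. -/
def extraPos (L x : ℕ) (e : ℕ → ℕ) (v : Fin (L + x)) : ℕ :=
  if v.val < L then v.val else e (v.val - L)

section ExtraPos

variable {L x : ℕ} {e : ℕ → ℕ}

theorem extraPos_of_lt {v : Fin (L + x)} (h : v.val < L) : extraPos L x e v = v.val :=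
  if_pos h

theorem extraPos_extra {j : ℕ} (h : j < x) : extraPos L x e ⟨L + j, by omega⟩ = e j := by
  simp [extraPos]

theorem exists_extra_of_le {v : Fin (L + x)} (h : L ≤ v.val) :
    ∃ j < x, v.val = L + j ∧ extraPos L x e v = e j := by
  refine ⟨v.val - L, by omega, by omega, if_neg (by omega)⟩

theorem isLayering_extraPos {C : ℕ → Prop} (he : ∀ j < x, e j < L) (hL : 0 < L)
    (hC : 2 ≤ L ∨ ∀ p, C p) : IsLayering (extraPos L x e) C L where
  lt v := by
    rcases lt_or_ge v.val L with h | h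
    · rwa [extraPos_of_lt h]
    · obtain ⟨j, hj, -, hv⟩ := exists_extra_of_le (e := e) h
      rw [hv]
      exact he j hj
  surj p hp := ⟨⟨p, by omega⟩, extraPos_of_lt hp⟩
  two_le_or := hC
  pos_length := hL

theorem injOn_extraPos_compl {S : Set (Fin (L + x))} (hS : ∀ v, L ≤ v.val → v ∈ S) :
    Set.InjOn (extraPos L x e) Sᶜ := by
  intro u hu v hv huv
  have h1 : u.val < L := not_le.1 fun h => hu (hS u h)
  have h2 : v.val < L := not_le.1 fun h => hv (hS v h)
  rw [extraPos_of_lt h1, extraPos_of_lt h2] at huv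
  exact Fin.ext huv

theorem ncard_extras_le : {v : Fin (L + x) | L ≤ v.val}.ncard ≤ x := by
  refine (ncard_le_card_of_val_mem (Finset.Ico L (L + x)) fun v hv => ?_).trans (by simp)
  exact Finset.mem_Ico.2 ⟨hv, v.isLt⟩

theorem metricDim_extraPos_of_far {C : ℕ → Prop} (h : IsLayering (extraPos L x e) C L)
    {i j : ℕ} (hi : i < x) (hj : j < x) (hij : e i + 3 ≤ e j) :
    metricDim (layerGraph (extraPos L x e) C) = x := by
  refine metricDim_eq {v | L ≤ v.val} ?_ ncard_extras_le fun T hT => ?_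
  · refine h.locating_of_far (injOn_extraPos_compl fun _ hv => hv)
      (s := ⟨L + i, by omega⟩) (t := ⟨L + j, by omega⟩) (by simp) (by simp) ?_
    rwa [extraPos_extra hi, extraPos_extra hj]
  · have := h.card_le_of_locating hT
    rw [Nat.card_fin] at this
    omega

end ExtraPos

section BlockPath

variable {a x : ℕ} {e : ℕ → ℕ}

theorem domNum_extraPos (h : IsLayering (extraPos (3 * a) x e) (fun p => p % 3 = 1) (3 * a)) :
    domNum (layerGraph (extraPos (3 * a) x e) fun p => p % 3 = 1) = a := by
  refine domNum_eq {v | v.val < 3 * a ∧ v.val % 3 = 1} ?_ ?_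
    fun T hT => le_ncard_of_dominating_blocks h hT
  · intro v hv
    have hlt := h.lt v
    have hu : extraPos (3 * a) x e ⟨3 * (extraPos (3 * a) x e v / 3) + 1, by omega⟩ =
      3 * (extraPos (3 * a) x e v / 3) + 1 := extraPos_of_lt (by simp only; omega)
    refine ⟨⟨3 * (extraPos (3 * a) x e v / 3) + 1, by omega⟩,
      ⟨by simp only; omega, by simp only; omega⟩, ?_, ?_⟩
    · intro hne
      have := congrArg Fin.val hne
      simp only at this
      exact hv ⟨by omega, by omega⟩
    · rw [hu]
      omega
  · refine (ncard_le_card_of_val_mem ((Finset.range a).image fun i => 3 * i + 1)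
      fun v hv => ?_).trans (Finset.card_image_le.trans (by simp))
    obtain ⟨h1, h2⟩ := hv
    exact Finset.mem_image.2 ⟨v.val / 3, Finset.mem_range.2 (by omega), by omega⟩

theorem mldNum_extraPos (h : IsLayering (extraPos (3 * a) x e) (fun p => p % 3 = 1) (3 * a))
    (he : ∀ j < x, e j % 3 = 1 ∨ e j = 0 ∨ e j + 1 = 3 * a)
    (hfar : x = 0 ∧ 2 ≤ a ∨ ∃ i < x, ∃ j < x, e i + 3 ≤ e j) (B : Finset ℕ)
    (hB : ∀ i, i ∈ B ↔ i < a ∧ ∀ j < x, e j ≠ 3 * i + 1) :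
    mldNum (layerGraph (extraPos (3 * a) x e) fun p => p % 3 = 1) = x + B.card := by
  have hval : ∀ u v : Fin (3 * a + x), extraPos (3 * a) x e u = extraPos (3 * a) x e v →
      (∀ j < x, e j ≠ extraPos (3 * a) x e u) → u = v := by
    intro u v huv hj
    have hu : u.val < 3 * a := not_le.1 fun hu => by
      obtain ⟨j, hjx, -, hju⟩ := exists_extra_of_le (e := e) hu
      exact hj j hjx hju.symm
    have hv : v.val < 3 * a := not_le.1 fun hv => by
      obtain ⟨j, hjx, -, hjv⟩ := exists_extra_of_le (e := e) hv
      exact hj j hjx (hjv.symm.trans huv.symm)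
    rw [extraPos_of_lt hu, extraPos_of_lt hv] at huv
    exact Fin.ext huv
  refine mldNum_eq {v | 3 * a ≤ v.val ∨ v.val % 3 = 1 ∧ v.val / 3 ∈ B} ?_ ?_ ?_ fun T hD hT => ?_
  · intro v hv
    simp only [Set.mem_ofPred_eq, not_or, not_and, not_le] at hv
    obtain ⟨hv1, hv2⟩ := hv
    have hpv := extraPos_of_lt (x := x) (e := e) hv1
    by_cases hi : v.val / 3 ∈ B
    · have hpu : extraPos (3 * a) x e ⟨3 * (v.val / 3) + 1, by omega⟩ = 3 * (v.val / 3) + 1 :=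
        extraPos_of_lt (by simp only; omega)
      have hv3 : v.val % 3 ≠ 1 := fun h3 => hv2 h3 hi
      refine ⟨⟨3 * (v.val / 3) + 1, by omega⟩, Or.inr ⟨by simp only; omega, ?_⟩, ?_, ?_⟩
      · have h3 : (3 * (v.val / 3) + 1) / 3 = v.val / 3 := by omega
        simpa only [h3] using hi
      · rintro hne
        have := congrArg Fin.val hne
        simp only at this
        omega
      · rw [hpu, hpv]
        omega
    · rw [hB] at hi
      push Not at hi
      obtain ⟨j, hj, hej⟩ := hi (by omega)
      refine ⟨⟨3 * a + j, by omega⟩, Or.inl (by simp), ?_, ?_⟩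
      · rintro hne
        have := congrArg Fin.val hne
        simp only at this
        omega
      · rw [extraPos_extra hj, hpv, hej]
        omega
  · have hinj := injOn_extraPos_compl (e := e)
      (S := {v : Fin (3 * a + x) | 3 * a ≤ v.val ∨ v.val % 3 = 1 ∧ v.val / 3 ∈ B})
      fun v hv => Or.inl hv
    rcases hfar with ⟨rfl, ha⟩ | ⟨i, hi, j, hj, hij⟩
    · refine h.locating_of_far hinj (s := ⟨1, by omega⟩) (t := ⟨4, by omega⟩)
        (Or.inr ⟨by simp, (hB _).2 ⟨by simp only; omega, by simp⟩⟩)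
        (Or.inr ⟨by simp, (hB _).2 ⟨by simp only; omega, by simp⟩⟩) ?_
      rw [extraPos_of_lt (by simp only; omega), extraPos_of_lt (by simp only; omega)]
    · refine h.locating_of_far hinj (s := ⟨3 * a + i, by omega⟩) (t := ⟨3 * a + j, by omega⟩)
        (Or.inl (by simp)) (Or.inl (by simp)) ?_
      rwa [extraPos_extra hi, extraPos_extra hj]
  · refine (ncard_le_card_of_val_mem
      (Finset.Ico (3 * a) (3 * a + x) ∪ B.image fun i => 3 * i + 1) fun v hv => ?_).trans
      ((Finset.card_union_le _ _).trans (add_le_add (by simp) Finset.card_image_le))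
    rcases hv with hv | ⟨h1, h2⟩
    · exact Finset.mem_union_left _ (Finset.mem_Ico.2 ⟨hv, v.isLt⟩)
    · exact Finset.mem_union_right _ (Finset.mem_image.2 ⟨v.val / 3, h2, by omega⟩)
  · have := card_add_card_le_of_dominating_locating h
      (fun u v huv h1 h2 h3 => hval u v huv fun j hj hju => by
        have := he j hj
        omega)
      hD hT B fun i hi => ⟨((hB i).1 hi).1, fun u v hu hv =>
        hval u v (hu.trans hv.symm) fun j hj => hu ▸ ((hB i).1 hi).2 j hj⟩
    rw [Nat.card_fin] at this
    omega

end BlockPath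

theorem exists_graph_of_two_le (a b k : ℕ) (ha : 2 ≤ a) (hb : 2 ≤ b) (hka : k ≤ a)
    (hkb : k ≤ b) :
    ∃ (n : ℕ) (G : SimpleGraph (Fin n)), G.Connected ∧
      domNum G = a ∧ metricDim G = b ∧ mldNum G = b + (a - k) := by
  let e : ℕ → ℕ := fun j =>
    if j = 0 then (if k = 0 then 0 else 1)
    else if k ≤ 1 then 3 * a - 1
    else if j < k - 1 then 3 * j + 1 else 3 * a - 2
  have he : ∀ j, e j < 3 * a ∧ (e j % 3 = 1 ∨ e j = 0 ∨ e j + 1 = 3 * a) := by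
    intro j
    simp only [e]
    split_ifs <;> omega
  have h : IsLayering (extraPos (3 * a) b e) (fun p => p % 3 = 1) (3 * a) :=
    isLayering_extraPos (fun j _ => (he j).1) (by omega) (Or.inl (by omega))
  have hfar : e 0 + 3 ≤ e (b - 1) := by
    simp only [e]
    split_ifs <;> omega
  let N : Finset ℕ := (Finset.range k).image fun j => e j / 3
  have hN : N.card = k := by
    rw [Finset.card_image_of_injOn, Finset.card_range]
    intro i hi j hj hij
    simp only [Finset.coe_range, Set.mem_Iio] at hi hj
    simp only [e] at hij
    split_ifs at hij <;> omega
  have hNa : N ⊆ Finset.range a := by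
    intro i hi
    obtain ⟨j, -, rfl⟩ := Finset.mem_image.1 hi
    have := (he j).1
    exact Finset.mem_range.2 (by omega)
  have hmld := mldNum_extraPos h (fun j _ => (he j).2)
    (Or.inr ⟨0, by omega, b - 1, by omega, hfar⟩) (Finset.range a \ N) (fun i => by
      rw [Finset.mem_sdiff, Finset.mem_range]
      refine and_congr_right fun hi => ⟨fun hiN j hj hji => hiN ?_, fun hj hiN => ?_⟩
      · rw [Finset.mem_image]
        by_cases hjk : j < k
        · exact ⟨j, Finset.mem_range.2 hjk, by omega⟩
        · refine ⟨k - 1, Finset.mem_range.2 ?_, ?_⟩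
          · simp only [e] at hji
            split_ifs at hji <;> omega
          · simp only [e] at hji ⊢
            split_ifs at hji ⊢ <;> omega
      · obtain ⟨j, hjk, rfl⟩ := Finset.mem_image.1 hiN
        rw [Finset.mem_range] at hjk
        refine hj j (by omega) ?_
        simp only [e]
        split_ifs <;> omega)
  rw [Finset.card_sdiff_of_subset hNa, hN, Finset.card_range] at hmld
  exact ⟨_, _, h.connected, domNum_extraPos h,
    metricDim_extraPos_of_far h (by omega) (by omega) hfar, hmld⟩

theorem exists_path_graph (a : ℕ) (ha : 2 ≤ a) :
    ∃ (n : ℕ) (G : SimpleGraph (Fin n)), G.Connected ∧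
      domNum G = a ∧ metricDim G = 1 ∧ mldNum G = a := by
  have h : IsLayering (extraPos (3 * a) 0 id) (fun p => p % 3 = 1) (3 * a) :=
    isLayering_extraPos (by simp) (by omega) (Or.inl (by omega))
  have hmld := mldNum_extraPos h (by simp) (Or.inl ⟨rfl, ha⟩) (Finset.range a) (by simp)
  rw [Finset.card_range, zero_add] at hmld
  refine ⟨_, _, h.connected, domNum_extraPos h, ?_, hmld⟩
  have : Nontrivial (Fin (3 * a + 0)) := Fin.nontrivial_iff_two_le.2 (by omega)
  have hpos : ∀ v : Fin (3 * a + 0), extraPos (3 * a) 0 id v = v.val :=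
    fun v => extraPos_of_lt v.isLt
  refine metricDim_eq {⟨0, by omega⟩} (h.locating_of_injOn ?_ ?_) (by simp)
    fun T hT => one_le_ncard_of_locating hT
  · intro u _ v _ huv
    rw [hpos, hpos] at huv
    exact Fin.ext huv
  · intro u hu v hv huv
    refine ⟨_, rfl, ?_⟩
    have h1 := h.dist_cases hu
    have h2 := h.dist_cases hv
    simp only [hpos] at h1 h2 huv
    have hu0 : u.val ≠ 0 := fun e => hu (Fin.ext e)
    omega

theorem exists_complete_graph (b : ℕ) (hb : 1 ≤ b) :
    ∃ (n : ℕ) (G : SimpleGraph (Fin n)), G.Connected ∧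
      domNum G = 1 ∧ metricDim G = b ∧ mldNum G = b := by
  have h : IsLayering (extraPos 1 b fun _ => 0) (fun _ => True) 1 :=
    isLayering_extraPos (fun _ _ => one_pos) one_pos (Or.inr fun _ => trivial)
  have : Nonempty (Fin (1 + b)) := ⟨⟨0, by omega⟩⟩
  have hadj : ∀ u v, u ≠ v → (layerGraph (extraPos 1 b fun _ => 0) fun _ => True).Adj u v := by
    intro u v huv
    have hu := h.lt u
    have hv := h.lt v
    exact ⟨huv, Or.inl ⟨by omega, trivial⟩⟩
  have hdom : ∀ v, ∀ D : Set (Fin (1 + b)), v ∈ D →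
      Dominating (layerGraph (extraPos 1 b fun _ => 0) fun _ => True) D :=
    fun v D hv w hw => ⟨v, hv, hadj v w fun e => hw (e ▸ hv)⟩
  have hloc : Locating (layerGraph (extraPos 1 b fun _ => 0) fun _ => True)
      {v | 1 ≤ v.val} := by
    refine h.locating_of_injOn (injOn_extraPos_compl fun _ hv => hv) fun u _ v _ huv => ?_
    have hu := h.lt u
    have hv := h.lt v
    omega
  have hmin : ∀ T, Locating (layerGraph (extraPos 1 b fun _ => 0) fun _ => True) T →
      b ≤ T.ncard := fun T hT => by
    have := h.card_le_of_locating hT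
    rw [Nat.card_fin] at this
    omega
  exact ⟨_, _, h.connected,
    domNum_eq {⟨0, by omega⟩} (hdom _ _ rfl) (by simp) fun _ hT => one_le_ncard_of_dominating hT,
    metricDim_eq _ hloc ncard_extras_le hmin,
    mldNum_eq _ (hdom ⟨1, by omega⟩ _ le_rfl) hloc ncard_extras_le fun T _ hT => hmin T hT⟩

theorem exists_star_graph (b : ℕ) (hb : 1 ≤ b) :
    ∃ (n : ℕ) (G : SimpleGraph (Fin n)), G.Connected ∧
      domNum G = 1 ∧ metricDim G = b ∧ mldNum G = b + 1 := by
  have h : IsLayering (extraPos 2 b fun _ => 1) (fun _ => False) 2 :=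
    isLayering_extraPos (fun _ _ => one_lt_two) two_pos (Or.inl le_rfl)
  have : Nonempty (Fin (2 + b)) := ⟨⟨0, by omega⟩⟩
  have hpos : ∀ v : Fin (2 + b), v.val = 0 ∧ extraPos 2 b (fun _ => 1) v = 0 ∨
      v.val ≠ 0 ∧ extraPos 2 b (fun _ => 1) v = 1 := by
    intro v
    dsimp only [extraPos]
    split_ifs <;> omega
  have hdom : ∀ D : Set (Fin (2 + b)), ⟨0, by omega⟩ ∈ D →
      Dominating (layerGraph (extraPos 2 b fun _ => 1) fun _ => False) D := by
    intro D hD v hv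
    refine ⟨_, hD, layerGraph_adj_of_succ ?_⟩
    have h0 : v.val ≠ 0 := fun e => hv ((Fin.ext e : v = ⟨0, by omega⟩) ▸ hD)
    have h1 := hpos v
    have h2 := extraPos_of_lt (x := b) (e := fun _ => 1) (v := ⟨0, by omega⟩) two_pos
    simp only at h2
    omega
  have hloc : ∀ S : Set (Fin (2 + b)), (∀ v, 2 ≤ v.val → v ∈ S) →
      Locating (layerGraph (extraPos 2 b fun _ => 1) fun _ => False) S := by
    intro S hS
    refine h.locating_of_injOn (injOn_extraPos_compl hS) fun u hu v hv huv => ?_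
    have hx : (⟨2, by omega⟩ : Fin (2 + b)) ∈ S := hS _ le_rfl
    refine ⟨⟨2, by omega⟩, hx, ?_⟩
    have h1 := hpos ⟨2, by omega⟩
    have hu' := h.lt u
    have hv' := h.lt v
    simp only at h1
    have d1 := h.dist_of_lt (u := u) (v := ⟨2, by omega⟩) (by omega)
    have d2 := h.dist_of_pos_eq (u := v) (v := ⟨2, by omega⟩) (fun e => hv (e ▸ hx)) (by omega)
    rw [if_neg not_false] at d2
    omega
  have hmin : ∀ T, Locating (layerGraph (extraPos 2 b fun _ => 1) fun _ => False) T →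
      b ≤ T.ncard := fun T hT => by
    have := h.card_le_of_locating hT
    rw [Nat.card_fin] at this
    omega
  refine ⟨_, _, h.connected,
    domNum_eq {⟨0, by omega⟩} (hdom _ rfl) (by simp) fun _ hT => one_le_ncard_of_dominating hT,
    metricDim_eq _ (hloc _ fun _ hv => hv) ncard_extras_le hmin,
    mldNum_eq (insert ⟨0, by omega⟩ {v | 2 ≤ v.val}) (hdom _ (Set.mem_insert _ _))
      (hloc _ fun _ hv => Or.inr hv)
      ((Set.ncard_insert_le _ _).trans (Nat.add_le_add_right ncard_extras_le 1))
      fun T hD hT => ?_⟩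
  by_contra hlt
  have hcard := Set.ncard_add_ncard_compl T
  rw [Nat.card_fin] at hcard
  obtain ⟨u, hu, v, hv, huv⟩ := (Set.one_lt_ncard (s := Tᶜ) (Set.toFinite _)).1 (by omega)
  have hinj := h.injOn_compl_of_locating hT
  have hne : extraPos 2 b (fun _ => 1) u ≠ extraPos 2 b (fun _ => 1) v :=
    fun e => huv (hinj hu hv e)
  have key : ∀ c l : Fin (2 + b), c ∉ T → l ∉ T → c.val = 0 → l.val ≠ 0 → False := by
    intro c l hc hl hc0 hl0
    obtain ⟨w, hw, hwl⟩ := hD l hl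
    have h1 := hpos w
    have h2 := hpos l
    have h3 := hwl.2
    simp only [and_false, false_or] at h3
    have hwc : w = c := Fin.ext (by omega)
    exact hc (hwc ▸ hw)
  have hu' := hpos u
  have hv' := hpos v
  by_cases hu0 : u.val = 0
  · exact key u v hu hv hu0 (by omega)
  · exact key v u hv hu (by omega) hu0

theorem stmt14 (a b c : ℕ) (ha : 1 ≤ a) (hb : 1 ≤ b) (hc : 1 ≤ c)
    (h1 : max a b ≤ c) (h2 : c ≤ a + b)
    (h3 : ¬ (b = 1 ∧ 1 < a ∧ c = a + 1)) :
    ∃ (n : ℕ) (G : SimpleGraph (Fin n)), G.Connected ∧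
      domNum G = a ∧ metricDim G = b ∧ mldNum G = c := by
  have hca : a ≤ c := (le_max_left a b).trans h1
  have hcb : b ≤ c := (le_max_right a b).trans h1
  by_cases ha1 : a = 1
  · subst ha1
    obtain rfl | rfl : c = b ∨ c = b + 1 := by omega
    · exact exists_complete_graph c hb
    · exact exists_star_graph b hb
  by_cases hb1 : b = 1
  · subst hb1
    obtain rfl : c = a := by omega
    exact exists_path_graph c (by omega)
  · obtain ⟨n, G, hG⟩ := exists_graph_of_two_le a b (a + b - c) (by omega) (by omega)
      (by omega) (by omega)
    rw [show b + (a - (a + b - c)) = c by omega] at hG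
    exact ⟨n, G, hG⟩
end

section
/- There is no finite simple connected graph G with β(G) = 1, γ(G) = a for some integer a ≥ 2, and η(G) = a + 1. Equivalently, if G is a finite simple connected graph with metric dimension 1 and domination number at least 2, then η(G) = γ(G). -/
open SimpleGraph

variable {V : Type*}

/-- If the distance to `s` is injective, then every vertex that is at most as far from `s` as `v`
lies on a geodesic from `s` to `v`. -/
theorem dist_add_dist_of_injective {G : SimpleGraph V} (hG : G.Connected) {s : V}
    (hs : Function.Injective (G.dist s)) {u v : V} (huv : G.dist s u ≤ G.dist s v) :
    G.dist s u + G.dist u v = G.dist s v := by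
  obtain ⟨p, hp⟩ := hG.exists_walk_length_eq_dist s v
  have h₁ := dist_le (p.take (G.dist s u))
  have h₂ := dist_le (p.drop (G.dist s u))
  rw [Walk.take_length] at h₁
  rw [Walk.drop_length] at h₂
  have h₃ := hG.dist_triangle (u := s) (v := p.getVert (G.dist s u)) (w := v)
  have h₄ := hG.dist_triangle (u := s) (v := u) (w := v)
  have h : p.getVert (G.dist s u) = u := hs (by omega)
  rw [h] at h₂
  omega

/-- If a single vertex is locating, then so is every set with at least two vertices. -/
theorem Locating.of_one_lt_ncard [Finite V] {G : SimpleGraph V} (hG : G.Connected) {s : V}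
    (hs : Locating G {s}) {D : Set V} (hD : 1 < D.ncard) : Locating G D := by
  have inj : Function.Injective (G.dist s) := by
    intro u v huv
    by_contra h
    obtain ⟨x, rfl, hx⟩ := hs u v h
    exact hx (by rw [dist_comm, huv, dist_comm])
  obtain ⟨x, hx, y, hy, hxy⟩ := (Set.one_lt_ncard (Set.toFinite D)).1 hD
  intro u v huv
  by_contra! h
  have key : ∀ a b : V, G.dist s a + G.dist a b = G.dist s b ∨
      G.dist s b + G.dist a b = G.dist s a := by
    intro a b
    rcases le_total (G.dist s a) (G.dist s b) with hab | hab
    · exact .inl (dist_add_dist_of_injective hG inj hab)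
    · exact .inr (G.dist_comm (u := a) (v := b) ▸ dist_add_dist_of_injective hG inj hab)
  have hux := key u x
  have hvx := key v x
  have huy := key u y
  have hvy := key v y
  have hx' := h x hx
  have hy' := h y hy
  have huv' := inj.ne huv
  have hxy' := inj.ne hxy
  omega

theorem stmt15 [Fintype V] (G : SimpleGraph V) (hG : G.Connected)
    (hβ : metricDim G = 1) (hγ : 2 ≤ domNum G) :
    mldNum G = domNum G := by
  have hmd : {k | ∃ S : Set V, Locating G S ∧ S.ncard = k}.Nonempty :=
    Nat.nonempty_of_pos_sInf (by change 0 < metricDim G; omega)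
  obtain ⟨S, hS, hcard⟩ := Nat.sInf_mem hmd
  obtain ⟨s, rfl⟩ := Set.ncard_eq_one.1 (hcard.trans hβ)
  have hset : {k | ∃ S : Set V, Dominating G S ∧ Locating G S ∧ S.ncard = k} =
      {k | ∃ D : Set V, Dominating G D ∧ D.ncard = k} := by
    ext k
    constructor
    · rintro ⟨D, hD, -, hk⟩
      exact ⟨D, hD, hk⟩
    · rintro ⟨D, hD, hk⟩
      have hle : domNum G ≤ D.ncard := Nat.sInf_le ⟨D, hD, rfl⟩
      exact ⟨D, hD, hS.of_one_lt_ncard hG (by omega), hk⟩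
  rw [mldNum, domNum, hset]
end

section
/- For all integers a, b with 3 ≤ a ≤ b ≤ 2a − 2, there exists a finite tree T with η(T) = a and λ(T) = b. -/
open SimpleGraph

variable {V : Type*}

/-! ### Invariance under graph isomorphisms -/

section Iso

variable {W : Type*} {G : SimpleGraph V} {H : SimpleGraph W}

theorem dist_map_le_of_connected (hG : G.Connected) (f : G →g H) (u v : V) :
    H.dist (f u) (f v) ≤ G.dist u v := by
  obtain ⟨p, hp⟩ := hG.exists_walk_length_eq_dist u v
  rw [← hp, ← p.length_map f]
  exact dist_le _

theorem Dominating.preimage_iso {D : Set W} (hD : Dominating H D) (φ : G ≃g H) :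
    Dominating G (φ ⁻¹' D) := by
  intro v hv
  obtain ⟨u, hu, huv⟩ := hD (φ v) hv
  refine ⟨φ.symm u, by simpa using hu, ?_⟩
  rw [← φ.map_adj_iff]
  simpa using huv

theorem Locating.preimage_iso {S : Set W} (hS : Locating H S) (hG : G.Connected)
    (φ : G ≃g H) : Locating G (φ ⁻¹' S) := by
  intro u v huv
  have hH : H.Connected := φ.connected_iff.mp hG
  have hdist : ∀ x y, H.dist (φ x) y = G.dist x (φ.symm y) := fun x y ↦ by
    apply le_antisymm
    · simpa using dist_map_le_of_connected hG φ.toHom x (φ.symm y)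
    · simpa using dist_map_le_of_connected hH φ.symm.toHom (φ x) y
  obtain ⟨x, hx, hne⟩ := hS (φ u) (φ v) (φ.injective.ne huv)
  exact ⟨φ.symm x, by simpa using hx, by rwa [← hdist, ← hdist]⟩

theorem LocatingDominating.preimage_iso {D : Set W} (hD : LocatingDominating H D)
    (φ : G ≃g H) : LocatingDominating G (φ ⁻¹' D) := by
  refine ⟨hD.1.preimage_iso φ, fun u hu v hv huv heq ↦ ?_⟩
  refine hD.2 (φ u) hu (φ v) hv (φ.injective.ne huv) ?_
  ext x
  have hx := Set.ext_iff.mp heq (φ.symm x)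
  simpa [← φ.map_adj_iff] using hx

theorem ncard_preimage_iso (φ : G ≃g H) (D : Set W) : (φ ⁻¹' D).ncard = D.ncard :=
  Set.ncard_preimage_of_injective_subset_range φ.injective (by simp [φ.surjective.range_eq])

theorem mldNum_congr (hG : G.Connected) (φ : G ≃g H) : mldNum G = mldNum H := by
  have hH : H.Connected := φ.connected_iff.mp hG
  unfold mldNum
  congr 1
  ext k
  constructor
  · rintro ⟨S, h1, h2, rfl⟩
    exact ⟨φ.symm ⁻¹' S, h1.preimage_iso _, h2.preimage_iso hH _, ncard_preimage_iso _ _⟩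
  · rintro ⟨S, h1, h2, rfl⟩
    exact ⟨φ ⁻¹' S, h1.preimage_iso _, h2.preimage_iso hG _, ncard_preimage_iso _ _⟩

theorem locDomNum_congr (φ : G ≃g H) : locDomNum G = locDomNum H := by
  unfold locDomNum
  congr 1
  ext k
  constructor
  · rintro ⟨S, h1, rfl⟩
    exact ⟨φ.symm ⁻¹' S, h1.preimage_iso _, ncard_preimage_iso _ _⟩
  · rintro ⟨S, h1, rfl⟩
    exact ⟨φ ⁻¹' S, h1.preimage_iso _, ncard_preimage_iso _ _⟩

end Iso

/-! ### Distances -/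

theorem dist_le_dist_of_neighborSet_subset {G : SimpleGraph V} (hG : G.Connected) {u v x : V}
    (h : G.neighborSet u ⊆ G.neighborSet v) (hx : x ≠ u) : G.dist v x ≤ G.dist u x := by
  obtain ⟨p, hp⟩ := hG.exists_walk_length_eq_dist u x
  rw [← hp]
  cases p with
  | nil => exact absurd rfl hx
  | cons hadj q => exact dist_le (Walk.cons (h hadj) q)

theorem Locating.mem_or_mem_of_neighborSet_eq {G : SimpleGraph V} (hG : G.Connected) {S : Set V}
    (hS : Locating G S) {u v : V} (huv : u ≠ v) (h : G.neighborSet u = G.neighborSet v) :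
    u ∈ S ∨ v ∈ S := by
  by_contra! hc
  obtain ⟨x, hx, hne⟩ := hS u v huv
  have hxu : x ≠ u := fun e ↦ hc.1 (e ▸ hx)
  have hxv : x ≠ v := fun e ↦ hc.2 (e ▸ hx)
  exact hne <| le_antisymm (dist_le_dist_of_neighborSet_subset hG h.ge hxv)
    (dist_le_dist_of_neighborSet_subset hG h.le hxu)

theorem dist_ne_dist_of_common_neighbor {G : SimpleGraph V} (hG : G.Connected) {u v x t : V}
    (hut : G.Adj u t) (htx : G.Adj t x) (hvx : v ≠ x) (hadj : ¬ G.Adj v x)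
    (h : ∀ s, G.Adj v s → ¬ G.Adj s x) : G.dist u x ≠ G.dist v x := by
  intro heq
  have hle : G.dist u x ≤ 2 := dist_le (Walk.cons hut (Walk.cons htx Walk.nil))
  obtain ⟨p, hp⟩ := hG.exists_walk_length_eq_dist v x
  rw [heq, ← hp] at hle
  match p, hle with
  | .nil, _ => exact hvx rfl
  | .cons e .nil, _ => exact hadj e
  | .cons e (.cons e' .nil), _ => exact h _ e e'
  | .cons _ (.cons _ (.cons _ _)), hle => simp at hle

theorem dist_ne_dist_of_adj {G : SimpleGraph V} {u v x : V}
    (hu : G.Adj u x) (hv : ¬ G.Adj v x) : G.dist u x ≠ G.dist v x := by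
  rw [dist_eq_one_iff_adj.mpr hu]
  exact fun h ↦ hv (dist_eq_one_iff_adj.mp h.symm)

theorem dist_ne_dist_self {G : SimpleGraph V} (hG : G.Connected) {u v : V} (huv : u ≠ v) :
    G.dist u u ≠ G.dist v u := by
  rw [dist_self]
  exact (hG.pos_dist_of_ne huv.symm).ne

/-! ### Graphs given by a parent function -/

/-- The graph joining each vertex to its parent. -/
def parentGraph (p : V → V) : SimpleGraph V := SimpleGraph.fromRel fun u v ↦ p u = v

theorem parentGraph_adj {p : V → V} {u v : V} :
    (parentGraph p).Adj u v ↔ u ≠ v ∧ (p u = v ∨ p v = u) := by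
  simp [parentGraph]

theorem parentGraph_connected {p : V → V} {r : V} (d : V → ℕ)
    (hd : ∀ v, v ≠ r → d (p v) < d v) : (parentGraph p).Connected := by
  have key : ∀ n v, d v = n → (parentGraph p).Reachable v r := by
    intro n
    induction n using Nat.strong_induction_on with
    | _ n ih =>
      rintro v rfl
      by_cases hv : v = r
      · rw [hv]
      have hlt := hd v hv
      have hadj : (parentGraph p).Adj v (p v) :=
        parentGraph_adj.mpr ⟨fun e ↦ by rw [← e] at hlt; exact hlt.false, Or.inl rfl⟩
      exact hadj.reachable.trans (ih _ hlt _ rfl)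
  have : Nonempty V := ⟨r⟩
  exact ⟨fun u v ↦ (key _ u rfl).trans (key _ v rfl).symm⟩

theorem parentGraph_isTree [Finite V] {p : V → V} {r : V} (hr : p r = r) (d : V → ℕ)
    (hd : ∀ v, v ≠ r → d (p v) < d v) : (parentGraph p).IsTree := by
  have hconn := parentGraph_connected d hd
  refine isTree_iff_connected_and_card.mpr ⟨hconn, ?_⟩
  refine le_antisymm ?_ hconn.card_vert_le_card_edgeSet_add_one
  have hsub : (parentGraph p).edgeSet ⊆ (fun v ↦ s(v, p v)) '' {r}ᶜ := by
    intro e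
    induction e with
    | _ u v =>
      rw [mem_edgeSet, parentGraph_adj]
      rintro ⟨hne, rfl | rfl⟩
      · exact ⟨u, fun h ↦ hne (by rw [Set.mem_singleton_iff.mp h, hr]), rfl⟩
      · exact ⟨v, fun h ↦ hne (by rw [Set.mem_singleton_iff.mp h, hr]), Sym2.eq_swap⟩
  have h1 := (Set.ncard_le_ncard hsub).trans (Set.ncard_image_le)
  have h2 := Set.ncard_add_ncard_compl {r}
  rw [Set.ncard_singleton] at h2
  rw [Nat.card_coe_set_eq]
  lia

/-! ### Spiders with legs of length one and four -/

/-- Vertices of the spider with `m` legs of length one and `c` legs of length four; the vertices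
of a long leg are `near i`, `middle i`, `stem i`, `tip i`, from the hub outwards. -/
inductive SpiderVertex (m c : ℕ)
  | hub : SpiderVertex m c
  | leaf (j : Fin m) : SpiderVertex m c
  | near (i : Fin c) : SpiderVertex m c
  | middle (i : Fin c) : SpiderVertex m c
  | stem (i : Fin c) : SpiderVertex m c
  | tip (i : Fin c) : SpiderVertex m c
  deriving Fintype

namespace SpiderVertex

variable {m c : ℕ}

/-- The neighbor towards the hub. -/
def parent : SpiderVertex m c → SpiderVertex m c
  | hub => hub
  | leaf _ => hub
  | near _ => hub
  | middle i => near i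
  | stem i => middle i
  | tip i => stem i

/-- The distance to the hub. -/
def depth : SpiderVertex m c → ℕ
  | hub => 0
  | leaf _ => 1
  | near _ => 1
  | middle _ => 2
  | stem _ => 3
  | tip _ => 4

end SpiderVertex

open SpiderVertex

/-- The spider with `m` legs of length one and `c` legs of length four. -/
def spider (m c : ℕ) : SimpleGraph (SpiderVertex m c) := parentGraph parent

section Spider

variable {m c : ℕ}

theorem spider_isTree : (spider m c).IsTree :=
  parentGraph_isTree (r := hub) rfl depth fun v hv ↦ by cases v <;> simp_all [parent, depth]

theorem spider_adj {u v : SpiderVertex m c} :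
    (spider m c).Adj u v ↔ u ≠ v ∧ (parent u = v ∨ parent v = u) := parentGraph_adj

theorem spider_adj_leaf {u : SpiderVertex m c} {j : Fin m} :
    (spider m c).Adj u (leaf j) ↔ u = hub := by
  cases u <;> simp [spider_adj, parent]

theorem spider_adj_near {u : SpiderVertex m c} {i : Fin c} :
    (spider m c).Adj u (near i) ↔ u = hub ∨ u = middle i := by
  cases u <;> simp [spider_adj, parent]

theorem spider_adj_middle {u : SpiderVertex m c} {i : Fin c} :
    (spider m c).Adj u (middle i) ↔ u = near i ∨ u = stem i := by
  cases u <;> simp [spider_adj, parent, eq_comm]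

theorem spider_adj_stem {u : SpiderVertex m c} {i : Fin c} :
    (spider m c).Adj u (stem i) ↔ u = middle i ∨ u = tip i := by
  cases u <;> simp [spider_adj, parent, eq_comm]

theorem spider_adj_tip {u : SpiderVertex m c} {i : Fin c} :
    (spider m c).Adj u (tip i) ↔ u = stem i := by
  cases u <;> simp [spider_adj, parent, eq_comm]

theorem spider_adj_hub {u : SpiderVertex m c} :
    (spider m c).Adj u hub ↔ (∃ j, u = leaf j) ∨ ∃ i, u = near i := by
  cases u <;> simp [spider_adj, parent]

theorem neighborSet_leaf (j : Fin m) : (spider m c).neighborSet (leaf j) = {hub} := by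
  ext u
  simp [(spider m c).adj_comm (leaf j) u, spider_adj_leaf]

theorem Dominating.stem_mem_or_tip_mem {D : Set (SpiderVertex m c)}
    (hD : Dominating (spider m c) D) (i : Fin c) : stem i ∈ D ∨ tip i ∈ D := by
  by_contra! h
  obtain ⟨u, hu, hadj⟩ := hD _ h.2
  rw [spider_adj_tip] at hadj
  exact h.1 (hadj ▸ hu)

/-- A dominating set missing at most one leaf has as many vertices among the hub and the leaves
as there are leaves. -/
theorem Dominating.exists_injective_leaf {D : Set (SpiderVertex m c)}
    (hD : Dominating (spider m c) D) (h : ∀ j j', j ≠ j' → leaf j ∈ D ∨ leaf j' ∈ D) :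
    ∃ f : Fin m → SpiderVertex m c, f.Injective ∧
      ∀ j, f j ∈ D ∧ (f j = hub ∨ f j = leaf j) := by
  classical
  refine ⟨fun j ↦ if leaf j ∈ D then leaf j else hub, fun j j' hjj ↦ ?_, fun j ↦ ?_⟩
  · by_contra hne
    have := h j j' hne
    grind
  · by_cases hj : leaf j ∈ D
    · simp [hj]
    · obtain ⟨u, hu, hadj⟩ := hD _ hj
      rw [spider_adj_leaf] at hadj
      subst hadj
      simp [hj, hu]

theorem le_ncard_of_mld {S : Set (SpiderVertex m c)} (hD : Dominating (spider m c) S)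
    (hL : Locating (spider m c) S) : m + c ≤ S.ncard := by
  obtain ⟨f, hf, hfS⟩ := hD.exists_injective_leaf fun j j' hj ↦
    hL.mem_or_mem_of_neighborSet_eq spider_isTree.connected (by simpa using hj)
      (by simp [neighborSet_leaf])
  have hleg : ∀ i, ∃ v ∈ S, v = stem i ∨ v = tip i := fun i ↦ by
    rcases hD.stem_mem_or_tip_mem i with h | h
    exacts [⟨_, h, .inl rfl⟩, ⟨_, h, .inr rfl⟩]
  choose g hgS hg using hleg
  have hinj : (Sum.elim f g).Injective := hf.sumElim
    (fun i i' h ↦ by have := hg i; have := hg i'; grind)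
    (fun j i h ↦ by have := hfS j; have := hg i; grind)
  calc m + c = (Set.range (Sum.elim f g)).ncard := by
        rw [Set.ncard_range_of_injective hinj]; simp
    _ ≤ S.ncard := Set.ncard_le_ncard <| by
        rintro _ ⟨j | i, rfl⟩
        exacts [(hfS j).1, hgS i]

theorem LocatingDominating.exists_ne_mem_leg {D : Set (SpiderVertex m c)}
    (hD : LocatingDominating (spider m c) D) (i : Fin c) :
    ∃ v w, v ≠ w ∧ v ∈ D ∧ w ∈ D ∧
      (v = stem i ∨ v = tip i) ∧
      (w = near i ∨ w = middle i ∨ w = tip i) := by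
  by_cases hx : near i ∈ D
  · rcases hD.1.stem_mem_or_tip_mem i with h | h
    exacts [⟨_, _, by simp, h, hx, by simp, by simp⟩, ⟨_, _, by simp, h, hx, by simp, by simp⟩]
  by_cases hw : middle i ∈ D
  · rcases hD.1.stem_mem_or_tip_mem i with h | h
    exacts [⟨_, _, by simp, h, hw, by simp, by simp⟩, ⟨_, _, by simp, h, hw, by simp, by simp⟩]
  have hs : stem i ∈ D := by
    obtain ⟨u, hu, hadj⟩ := hD.1 _ hw
    rw [spider_adj_middle] at hadj
    rcases hadj with rfl | rfl
    exacts [absurd hu hx, hu]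
  by_cases ht : tip i ∈ D
  · exact ⟨_, _, by simp, hs, ht, by simp, by simp⟩
  refine absurd ?_ (hD.2 _ hw _ ht (by simp))
  ext u
  simp only [Set.mem_inter_iff, mem_neighborSet, (spider m c).adj_comm _ u, spider_adj_middle,
    spider_adj_tip]
  grind

theorem le_ncard_of_locatingDominating {D : Set (SpiderVertex m c)}
    (hD : LocatingDominating (spider m c) D) : m + (c + c) ≤ D.ncard := by
  obtain ⟨f, hf, hfS⟩ := hD.1.exists_injective_leaf fun j j' hj ↦ by
    by_contra! h
    exact hD.2 _ h.1 _ h.2 (by simpa using hj) (by simp [neighborSet_leaf])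
  choose g g' hne hgS hgS' hg hg' using hD.exists_ne_mem_leg
  have hinj : (Sum.elim f (Sum.elim g g')).Injective := hf.sumElim
    (Function.Injective.sumElim
      (fun i i' h ↦ by have := hg i; have := hg i'; grind)
      (fun i i' h ↦ by have := hg' i; have := hg' i'; grind)
      (fun i i' h ↦ by have := hne i; have := hg i; have := hg' i'; grind))
    (fun j i h ↦ by
      have := hfS j
      rcases i with i | i
      · have := hg i
        grind
      · have := hg' i
        grind)
  calc m + (c + c) = (Set.range (Sum.elim f (Sum.elim g g'))).ncard := by
        rw [Set.ncard_range_of_injective hinj]; simp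
    _ ≤ D.ncard := Set.ncard_le_ncard <| by
        rintro _ ⟨j | i | i, rfl⟩
        exacts [(hfS j).1, hgS i, hgS' i]

/-- The hub and all leaves but the first. -/
def hubOrLeaf (j : Fin (m + 1)) : SpiderVertex (m + 1) c := if j = 0 then hub else leaf j

theorem hubOrLeaf_injective :
    (hubOrLeaf : Fin (m + 1) → SpiderVertex (m + 1) c).Injective := by
  intro j j' h
  unfold hubOrLeaf at h
  grind

theorem exists_mld :
    ∃ S : Set (SpiderVertex (m + 1) c), Dominating (spider (m + 1) c) S ∧
      Locating (spider (m + 1) c) S ∧ S.ncard = m + 1 + c := by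
  have hconn := (spider_isTree (m := m + 1) (c := c)).connected
  have hinj : (Sum.elim hubOrLeaf stem : _ → SpiderVertex (m + 1) c).Injective :=
    hubOrLeaf_injective.sumElim (fun _ _ h ↦ by simpa using h)
      (fun j i ↦ by unfold hubOrLeaf; split_ifs <;> simp)
  set S : Set (SpiderVertex (m + 1) c) := Set.range (Sum.elim hubOrLeaf stem) with hS
  have hhub : hub ∈ S := ⟨.inl 0, rfl⟩
  have hstem : ∀ i, stem i ∈ S := fun i ↦ ⟨.inr i, rfl⟩
  have hleaf : ∀ j, j ≠ 0 → leaf j ∈ S := fun j hj ↦ ⟨.inl j, by simp [hubOrLeaf, hj]⟩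
  refine ⟨S, fun v hv ↦ ?_, fun u v huv ↦ ?_, by rw [hS, Set.ncard_range_of_injective hinj]; simp⟩
  · cases v with
    | hub => exact absurd hhub hv
    | leaf j => exact ⟨_, hhub, by simp [spider_adj_leaf]⟩
    | near i => exact ⟨_, hhub, by simp [spider_adj_near]⟩
    | middle i => exact ⟨_, hstem i, by simp [spider_adj_middle]⟩
    | stem i => exact absurd (hstem i) hv
    | tip i => exact ⟨_, hstem i, by simp [spider_adj_tip]⟩
  · by_cases hu : u ∈ S
    · exact ⟨u, hu, dist_ne_dist_self hconn huv⟩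
    by_cases hv : v ∈ S
    · exact ⟨v, hv, (dist_ne_dist_self hconn huv.symm).symm⟩
    by_cases hadj : ∃ x ∈ S, ¬ ((spider (m + 1) c).Adj u x ↔ (spider (m + 1) c).Adj v x)
    · obtain ⟨x, hx, hne⟩ := hadj
      refine ⟨x, hx, ?_⟩
      by_cases hux : (spider (m + 1) c).Adj u x
      · exact dist_ne_dist_of_adj hux (by tauto)
      · exact (dist_ne_dist_of_adj (by tauto) hux).symm
    push Not at hadj
    have hc := hadj _ hhub
    have hs := fun i ↦ hadj _ (hstem i)
    simp only [spider_adj_hub, spider_adj_stem] at hc hs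
    have hnear : ∀ i v, (∃ j, v = leaf j) ∨ (∃ j, j ≠ i ∧ v = near j) →
        (spider (m + 1) c).dist (near i) (stem i) ≠ (spider (m + 1) c).dist v (stem i) := by
      intro i v hv
      refine dist_ne_dist_of_common_neighbor hconn (t := middle i)
        (by simp [spider_adj_middle]) (by simp [spider_adj_stem]) ?_ ?_ fun s h1 h2 ↦ ?_
      · grind
      · grind [spider_adj_stem]
      · rw [spider_adj_stem] at h2
        rcases h2 with rfl | rfl
        · grind [spider_adj_middle]
        · grind [spider_adj_tip]
    have hmiddle : ∀ i, (spider (m + 1) c).dist (middle i) hub ≠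
        (spider (m + 1) c).dist (tip i) hub := by
      intro i
      refine dist_ne_dist_of_common_neighbor hconn (t := near i)
        (by simp [spider_adj_near]) (by simp [spider_adj_hub]) (by simp)
        (by simp [spider_adj_hub]) fun s h1 h2 ↦ ?_
      rw [(spider (m + 1) c).adj_comm, spider_adj_tip] at h1
      simp [h1, spider_adj_hub] at h2
    cases u with
    | hub => exact absurd hhub hu
    | stem i => exact absurd (hstem i) hu
    | leaf j =>
      cases v with
      | near i => exact ⟨_, hstem i, (hnear i _ (.inl ⟨j, rfl⟩)).symm⟩
      | leaf j' => grind
      | _ => simp_all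
    | near i =>
      cases v with
      | leaf j => exact ⟨_, hstem i, hnear i _ (.inl ⟨j, rfl⟩)⟩
      | near j => exact ⟨_, hstem i, hnear i _ (.inr ⟨j, by grind, rfl⟩)⟩
      | _ => simp_all
    | middle i =>
      cases v with
      | tip j =>
        obtain rfl : j = i := by simpa using hs i
        exact ⟨_, hhub, hmiddle _⟩
      | _ => simp_all
    | tip i =>
      cases v with
      | middle j =>
        obtain rfl : j = i := by simpa using hs i
        exact ⟨_, hhub, (hmiddle _).symm⟩
      | _ => simp_all

theorem exists_locatingDominating :
    ∃ D : Set (SpiderVertex (m + 1) c), LocatingDominating (spider (m + 1) c) D ∧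
      D.ncard = m + 1 + (c + c) := by
  have hinj : (Sum.elim hubOrLeaf (Sum.elim middle stem) :
      _ → SpiderVertex (m + 1) c).Injective :=
    hubOrLeaf_injective.sumElim
      (Function.Injective.sumElim (fun _ _ h ↦ by simpa using h) (fun _ _ h ↦ by simpa using h)
        (by simp))
      (fun j i ↦ by unfold hubOrLeaf; rcases i with i | i <;> split_ifs <;> simp)
  set D : Set (SpiderVertex (m + 1) c) :=
    Set.range (Sum.elim hubOrLeaf (Sum.elim middle stem)) with hD
  have hhub : hub ∈ D := ⟨.inl 0, rfl⟩
  have hmiddle : ∀ i, middle i ∈ D := fun i ↦ ⟨.inr (.inl i), rfl⟩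
  have hstem : ∀ i, stem i ∈ D := fun i ↦ ⟨.inr (.inr i), rfl⟩
  have hleaf : ∀ j, j ≠ 0 → leaf j ∈ D := fun j hj ↦ ⟨.inl j, by simp [hubOrLeaf, hj]⟩
  refine ⟨D, ⟨fun v hv ↦ ?_, fun u hu v hv huv heq ↦ ?_⟩,
    by rw [hD, Set.ncard_range_of_injective hinj]; simp⟩
  · cases v with
    | hub => exact absurd hhub hv
    | leaf j => exact ⟨_, hhub, by simp [spider_adj_leaf]⟩
    | near i => exact ⟨_, hhub, by simp [spider_adj_near]⟩
    | middle i => exact absurd (hmiddle i) hv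
    | stem i => exact absurd (hstem i) hv
    | tip i => exact ⟨_, hstem i, by simp [spider_adj_tip]⟩
  · have hc := Set.ext_iff.mp heq hub
    have hm := fun i ↦ Set.ext_iff.mp heq (middle i)
    have hs := fun i ↦ Set.ext_iff.mp heq (stem i)
    simp only [Set.mem_inter_iff, mem_neighborSet, hhub, hmiddle, hstem, and_true,
      spider_adj_hub, spider_adj_middle, spider_adj_stem] at hc hm hs
    cases u <;> cases v <;> grind

theorem mldNum_spider : mldNum (spider (m + 1) c) = m + 1 + c := by
  refine le_antisymm (Nat.sInf_le exists_mld) (le_csInf ⟨_, exists_mld⟩ ?_)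
  rintro _ ⟨S, h1, h2, rfl⟩
  exact le_ncard_of_mld h1 h2

theorem locDomNum_spider : locDomNum (spider (m + 1) c) = m + 1 + (c + c) := by
  refine le_antisymm (Nat.sInf_le exists_locatingDominating)
    (le_csInf ⟨_, exists_locatingDominating⟩ ?_)
  rintro _ ⟨D, h, rfl⟩
  exact le_ncard_of_locatingDominating h

end Spider

theorem stmt16 (a b : ℕ) (ha : 3 ≤ a) (hab : a ≤ b) (hb : b ≤ 2 * a - 2) :
    ∃ (n : ℕ) (T : SimpleGraph (Fin n)), T.IsTree ∧
      mldNum T = a ∧ locDomNum T = b := by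
  obtain ⟨c, rfl⟩ := Nat.exists_eq_add_of_le hab
  obtain ⟨m, rfl⟩ : ∃ m, a = m + 1 + c := ⟨a - c - 1, by lia⟩
  let e := Fintype.equivFin (SpiderVertex (m + 1) c)
  let φ : (spider (m + 1) c).comap e.symm ≃g spider (m + 1) c := Iso.comap e.symm _
  have htree := φ.isTree_iff.mpr spider_isTree
  refine ⟨_, _, htree, ?_, ?_⟩
  · rw [mldNum_congr htree.connected φ, mldNum_spider]
  · rw [locDomNum_congr φ, locDomNum_spider, add_assoc (m + 1)]
end

section
/- For every integer n > 3, the path P_n on n vertices satisfies λ(P_n) = ⌈2n/5⌉. -/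
open SimpleGraph

variable {V : Type*}

/-- The elements of a locating-dominating set supply three slots each, and every vertex of the path
outside the set occupies two of them. -/
theorem two_mul_le_five_mul_card (n : ℕ) (S : Finset ℕ) (hS : ∀ i ∈ S, i < n)
    (hdom : ∀ v < n, v ∉ S → v - 1 ∈ S ∨ v + 1 ∈ S)
    (hloc : ∀ v, v + 2 < n → v ∉ S → v + 2 ∉ S → v + 1 ∈ S → v - 1 ∉ S → v + 3 ∈ S) :
    2 * n ≤ 5 * S.card := by
  have hsub : S ⊆ Finset.range n := fun i hi => Finset.mem_range.2 (hS i hi)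
  have hcard := Finset.card_sdiff_add_card_eq_card hsub
  have key : ((Finset.range n \ S) ×ˢ Finset.range 2).card ≤ (S ×ˢ Finset.range 3).card := by
    refine Finset.card_le_card_of_injOn
      (fun p => if p.2 = 0 then (if p.1 - 1 ∈ S then (p.1 - 1, 0) else (p.1 + 1, 2))
        else (if p.1 + 1 ∈ S then (p.1 + 1, 1) else (p.1 - 1, 2))) ?_ ?_
    · rintro ⟨v, b⟩ h
      simp only [Finset.coe_product, Set.mem_prod, Finset.mem_coe, Finset.mem_sdiff,
        Finset.mem_range] at h ⊢
      have := hdom v h.1.1 h.1.2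
      split_ifs <;> simp_all
    · rintro ⟨u, a⟩ hu ⟨v, b⟩ hv h
      simp only [Finset.coe_product, Set.mem_prod, Finset.mem_coe, Finset.mem_sdiff,
        Finset.mem_range] at hu hv h
      obtain ⟨⟨hu, huS⟩, ha⟩ := hu
      obtain ⟨⟨hv, hvS⟩, hb⟩ := hv
      have hdu := hdom u hu huS
      have hdv := hdom v hv hvS
      have hluv : v = u + 2 → u + 1 ∈ S → u - 1 ∉ S → v + 1 ∈ S := by
        rintro rfl
        exact hloc u hv huS hvS
      have hlvu : u = v + 2 → v + 1 ∈ S → v - 1 ∉ S → u + 1 ∈ S := by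
        rintro rfl
        exact hloc v hu hvS huS
      clear hdom hloc hS hsub hcard
      rw [Prod.mk.injEq]
      split_ifs at h <;> rw [Prod.mk.injEq] at h <;> grind
  simp only [Finset.card_product, Finset.card_range] at key hcard
  omega

theorem LocatingDominating.two_mul_le_five_mul_ncard {n : ℕ} {D : Set (Fin n)}
    (hD : LocatingDominating (SimpleGraph.pathGraph n) D) : 2 * n ≤ 5 * D.ncard := by
  classical
  obtain ⟨hdom, hloc⟩ := hD
  have hmem : ∀ i, i ∈ D.toFinset.map Fin.valEmbedding ↔ ∃ h : i < n, (⟨i, h⟩ : Fin n) ∈ D := by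
    intro i
    simp only [Finset.mem_map, Set.mem_toFinset, Fin.valEmbedding_apply]
    exact ⟨fun ⟨x, hx, hxi⟩ => hxi ▸ ⟨x.2, hx⟩, fun ⟨h, hx⟩ => ⟨_, hx, rfl⟩⟩
  rw [Set.ncard_eq_toFinset_card', ← Finset.card_map Fin.valEmbedding]
  apply two_mul_le_five_mul_card
  · exact fun i hi => ((hmem i).1 hi).1
  · intro v hv hvD
    simp only [hmem] at hvD ⊢
    obtain ⟨u, hu, huv⟩ := hdom ⟨v, hv⟩ fun h => hvD ⟨hv, h⟩
    rw [SimpleGraph.pathGraph_adj] at huv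
    obtain h | h := huv <;> simp only at h
    · left
      have : v - 1 = u := by omega
      simpa [this] using hu
    · right
      simpa [h] using hu
  · intro v hv h0 h2 h1 hm
    simp only [hmem] at h0 h2 h1 hm ⊢
    by_contra h3
    obtain ⟨h1n, h1⟩ := h1
    refine hloc ⟨v, by omega⟩ (fun h => h0 ⟨_, h⟩) ⟨v + 2, hv⟩ (fun h => h2 ⟨_, h⟩) (by simp) ?_
    ext ⟨w, hw⟩
    simp only [Set.mem_inter_iff, SimpleGraph.mem_neighborSet, SimpleGraph.pathGraph_adj]
    refine and_congr_left fun hwD => ?_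
    have : w ≠ v + 3 := by rintro rfl; exact h3 ⟨_, hwD⟩
    have : w ≠ v - 1 := by rintro rfl; exact hm ⟨_, hwD⟩
    omega

theorem exists_locatingDominating_pathGraph (n : ℕ) (hn : 3 < n) :
    ∃ D : Set (Fin n), LocatingDominating (SimpleGraph.pathGraph n) D ∧
      D.ncard ≤ (2 * n + 4) / 5 := by
  let f : ℕ → Fin n := fun j => ⟨min (n - 1) (j / 2 * 5 + 1 + 2 * (j % 2)), by omega⟩
  have hmem : ∀ i : Fin n, i ∈ f '' (Finset.range ((2 * n + 4) / 5) : Set ℕ) ↔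
      i.1 % 5 = 1 ∨ i.1 % 5 = 3 ∨ (i.1 + 1 = n ∧ n % 5 ≠ 0) := by
    rintro ⟨i, hi⟩
    simp only [Set.mem_image, Finset.mem_coe, Finset.mem_range, f, Fin.mk.injEq]
    constructor
    · rintro ⟨j, hj, rfl⟩
      omega
    · rintro (h | h | h)
      · exact ⟨i / 5 * 2, by omega, by omega⟩
      · exact ⟨i / 5 * 2 + 1, by omega, by omega⟩
      · exact ⟨n / 5 * 2 + n % 5 / 3, by omega, by omega⟩
  refine ⟨f '' (Finset.range ((2 * n + 4) / 5) : Set ℕ), ⟨?_, ?_⟩, ?_⟩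
  · rintro ⟨v, hv⟩ hvD
    simp only [hmem, SimpleGraph.pathGraph_adj] at hvD ⊢
    by_cases h : v % 5 = 0
    · exact ⟨⟨v + 1, by omega⟩, by simp only; omega, by simp⟩
    · exact ⟨⟨v - 1, by omega⟩, by simp only; omega, by simp only; omega⟩
  · rintro ⟨u, hu⟩ huD ⟨v, hv⟩ hvD huv heq
    have key : ∀ w, w < n → (w % 5 = 1 ∨ w % 5 = 3 ∨ (w + 1 = n ∧ n % 5 ≠ 0)) →
        ((u + 1 = w ∨ w + 1 = u) ↔ (v + 1 = w ∨ w + 1 = v)) := by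
      intro w hw hwD
      have := Set.ext_iff.1 heq ⟨w, hw⟩
      simpa only [Set.mem_inter_iff, hmem, hwD, and_true, SimpleGraph.mem_neighborSet,
        SimpleGraph.pathGraph_adj] using this
    simp only [hmem] at huD hvD
    simp only [ne_eq, Fin.mk.injEq] at huv
    obtain h | h | h : u % 5 = 0 ∨ u % 5 = 2 ∨ u % 5 = 4 := by omega
    · have h1 := key (u + 1) (by omega) (by omega)
      have h2 : v = u + 2 := by omega
      have h3 := key (v + 1) (by omega) (by omega)
      omega
    · have h1 := key (u + 1) (by omega) (by omega)
      have h2 := key (u - 1) (by omega) (by omega)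
      omega
    · have h1 := key (u - 1) (by omega) (by omega)
      have h2 : v + 2 = u := by omega
      have h3 := key (v - 1) (by omega) (by omega)
      omega
  · exact (Set.ncard_image_le (Finset.finite_toSet _)).trans (by simp)

theorem stmt17 (n : ℕ) (hn : 3 < n) :
    (locDomNum (SimpleGraph.pathGraph n) : ℤ) = ⌈(2 * (n : ℚ)) / 5⌉ := by
  have hceil : ⌈(2 * (n : ℚ)) / 5⌉ = (((2 * n + 4) / 5 : ℕ) : ℤ) := by
    have h1 : 2 * n ≤ 5 * ((2 * n + 4) / 5) := by omega
    have h2 : 5 * ((2 * n + 4) / 5) < 2 * n + 5 := by omega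
    generalize (2 * n + 4) / 5 = m at h1 h2 ⊢
    have h1' : 2 * (n : ℚ) ≤ 5 * m := mod_cast h1
    have h2' : 5 * (m : ℚ) < 2 * n + 5 := mod_cast h2
    rw [Int.ceil_eq_iff]
    constructor <;> push_cast <;> linarith
  rw [hceil, Nat.cast_inj]
  obtain ⟨D, hD, hcard⟩ := exists_locatingDominating_pathGraph n hn
  unfold locDomNum
  apply le_antisymm
  · exact le_trans (Nat.sInf_le ⟨D, hD, rfl⟩) hcard
  · refine le_csInf ⟨_, D, hD, rfl⟩ ?_
    rintro _ ⟨E, hE, rfl⟩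
    have := hE.two_mul_le_five_mul_ncard
    omega
end

section
/- For every integer n > 3, the path P_n on n vertices satisfies η(P_n) = ⌈n/3⌉. -/
open SimpleGraph

variable {V : Type*}

/-- A walk in a path graph is at least as long as the difference of its endpoints. -/
lemma pathGraph_natDist_le_length {n : ℕ} {u v : Fin n} (p : (pathGraph n).Walk u v) :
    Nat.dist u v ≤ p.length := by
  induction p with
  | nil => simp
  | cons h p ih =>
    rw [pathGraph_adj] at h
    simp only [Walk.length_cons, Nat.dist] at *
    omega

lemma pathGraph_exists_walk_length {n : ℕ} (u : Fin n) (k : ℕ) (h : u.val + k < n) :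
    ∃ p : (pathGraph n).Walk u ⟨u.val + k, h⟩, p.length = k := by
  induction k with
  | zero => exact ⟨Walk.nil, rfl⟩
  | succ k ih =>
    obtain ⟨p, hp⟩ := ih (by omega)
    refine ⟨p.concat (pathGraph_adj.2 (Or.inl ?_)), ?_⟩
    · simp only; omega
    · simp [hp]

/-- Graph distance in a path graph is distance of natural numbers. -/
lemma pathGraph_dist {n : ℕ} (u v : Fin n) : (pathGraph n).dist u v = Nat.dist u v := by
  wlog huv : u ≤ v generalizing u v
  · rw [SimpleGraph.dist_comm, Nat.dist_comm, this v u (le_of_not_ge huv)]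
  have huv' : u.val ≤ v.val := huv
  obtain ⟨p, hp⟩ := pathGraph_exists_walk_length u (v.val - u.val) (by omega)
  have hv : (⟨u.val + (v.val - u.val), by omega⟩ : Fin n) = v := by ext; simp only; omega
  have h₂ := SimpleGraph.dist_le p
  rw [hp, hv] at h₂
  obtain ⟨q, hq⟩ := (pathGraph_preconnected n u v).exists_walk_length_eq_dist
  have h₁ := pathGraph_natDist_le_length q
  rw [Nat.dist_eq_sub_of_le huv'] at *
  omega

/-- Two distinct vertices of a path already locate all vertices. -/
lemma locating_pathGraph_of_mem {n : ℕ} {S : Set (Fin n)} {a b : Fin n} (ha : a ∈ S)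
    (hb : b ∈ S) (hab : a ≠ b) : Locating (pathGraph n) S := by
  intro u v huv
  by_contra! h
  have h₁ := h a ha
  have h₂ := h b hb
  simp only [pathGraph_dist, Nat.dist] at h₁ h₂
  rw [ne_eq, Fin.ext_iff] at hab huv
  omega

/-- Each vertex of a path dominates at most three vertices. -/
lemma Dominating.le_three_mul_ncard {n : ℕ} {S : Set (Fin n)}
    (hS : Dominating (pathGraph n) S) : n ≤ 3 * S.ncard := by
  classical
  have hsub : Finset.Icc 1 n ⊆
      (S.toFinset ×ˢ Finset.range 3).image (fun q => q.1.val + q.2) := by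
    intro k hk
    rw [Finset.mem_Icc] at hk
    obtain ⟨x, hx, hle, hge⟩ : ∃ x ∈ S, x.val ≤ k ∧ k ≤ x.val + 2 := by
      by_cases hv : (⟨k - 1, by omega⟩ : Fin n) ∈ S
      · exact ⟨_, hv, by simp only; omega, by simp only; omega⟩
      · obtain ⟨u, hu, hadj⟩ := hS _ hv
        rw [pathGraph_adj] at hadj
        simp only at hadj
        exact ⟨u, hu, by omega, by omega⟩
    refine Finset.mem_image.2 ⟨(x, k - x.val), ?_, by simp only; omega⟩
    simp only [Finset.mem_product, Set.mem_toFinset, Finset.mem_range]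
    exact ⟨hx, by omega⟩
  have h := (Finset.card_le_card hsub).trans Finset.card_image_le
  rw [Finset.card_product, Nat.card_Icc, Finset.card_range, ← Set.ncard_eq_toFinset_card'] at h
  omega

lemma exists_dominating_locating_pathGraph {n : ℕ} (hn : 3 < n) :
    ∃ S : Set (Fin n), Dominating (pathGraph n) S ∧ Locating (pathGraph n) S ∧
      S.ncard ≤ (n + 2) / 3 := by
  let f : Fin ((n + 2) / 3) → Fin n := fun k => ⟨min (3 * k.val + 1) (n - 1), by omega⟩
  refine ⟨Set.range f, ?_, ?_, ?_⟩
  · intro v hv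
    have hk : v.val / 3 < (n + 2) / 3 := by omega
    have hne : v ≠ f ⟨v.val / 3, hk⟩ := fun h => hv ⟨_, h.symm⟩
    refine ⟨_, ⟨⟨v.val / 3, hk⟩, rfl⟩, pathGraph_adj.2 ?_⟩
    rw [ne_eq, Fin.ext_iff] at hne
    simp only [f] at hne ⊢
    omega
  · refine locating_pathGraph_of_mem (a := f ⟨0, by omega⟩) (b := f ⟨1, by omega⟩)
      ⟨_, rfl⟩ ⟨_, rfl⟩ ?_
    rw [ne_eq, Fin.ext_iff]
    simp only [f]
    omega
  · rw [← Set.image_univ]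
    refine (Set.ncard_image_le Set.finite_univ).trans ?_
    simp [Set.ncard_univ]

theorem stmt18 (n : ℕ) (hn : 3 < n) :
    (mldNum (SimpleGraph.pathGraph n) : ℤ) = ⌈(n : ℚ) / 3⌉ := by
  obtain ⟨S, hD, hL, hS⟩ := exists_dominating_locating_pathGraph hn
  have hle : mldNum (pathGraph n) ≤ S.ncard := Nat.sInf_le ⟨S, hD, hL, rfl⟩
  obtain ⟨T, hT, -, hcard⟩ : mldNum (pathGraph n) ∈ _ :=
    Nat.sInf_mem (s := {k | ∃ S : Set (Fin n), Dominating (pathGraph n) S ∧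
      Locating (pathGraph n) S ∧ S.ncard = k}) ⟨_, S, hD, hL, rfl⟩
  have hge := hT.le_three_mul_ncard
  rw [hcard] at hge
  have hlt : 3 * mldNum (pathGraph n) < n + 3 := by omega
  symm
  rw [Int.ceil_eq_iff]
  have hge' : (n : ℚ) ≤ 3 * mldNum (pathGraph n) := by exact_mod_cast hge
  have hlt' : 3 * (mldNum (pathGraph n) : ℚ) < n + 3 := by exact_mod_cast hlt
  push_cast
  constructor <;> linarith
end

section
/- For every integer n > 6, the cycle C_n on n vertices satisfies λ(C_n) = ⌈2n/5⌉ and η(C_n) = ⌈n/3⌉. -/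
open SimpleGraph

variable {V : Type*}

/-- A lower bound that is attained determines an infimum of cardinalities. -/
theorem sInf_ncard_eq_s19 {V : Type*} {P : Set V → Prop} {K : ℕ} (hlow : ∀ D, P D → K ≤ D.ncard)
    {D : Set V} (hD : P D) (hcard : D.ncard ≤ K) :
    sInf {k | ∃ D : Set V, P D ∧ D.ncard = k} = K := by
  have hmem : D.ncard ∈ {k | ∃ D : Set V, P D ∧ D.ncard = k} := ⟨D, hD, rfl⟩
  refine le_antisymm ((Nat.sInf_le hmem).trans hcard) (le_csInf ⟨_, hmem⟩ ?_)
  rintro k ⟨E, hE, rfl⟩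
  exact hlow E hE

/-- Double counting of the edges leaving `D` in a graph of bounded degree. -/
theorem sum_card_neighbors_le {V : Type*} [Fintype V] [DecidableEq V] (G : SimpleGraph V)
    [DecidableRel G.Adj] {Δ : ℕ} (hdeg : ∀ v, G.degree v ≤ Δ) (D : Finset V) :
    ∑ v ∈ Dᶜ, (D.filter (G.Adj v)).card ≤ Δ * D.card := by
  have h := Finset.sum_card_bipartiteAbove_eq_sum_card_bipartiteBelow (s := Dᶜ) (t := D) G.Adj
  simp only [Finset.bipartiteAbove, Finset.bipartiteBelow] at h
  rw [h, mul_comm, ← smul_eq_mul]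
  refine Finset.sum_le_card_nsmul _ _ _ fun d _ => ?_
  refine le_trans (Finset.card_le_card ?_) (hdeg d)
  intro v hv
  simpa using (Finset.mem_filter.1 hv).2.symm

theorem Dominating.card_le {V : Type*} [Fintype V] (G : SimpleGraph V)
    [DecidableRel G.Adj] {Δ : ℕ} (hdeg : ∀ v, G.degree v ≤ Δ) {D : Set V}
    (hD : Dominating G D) : Fintype.card V ≤ (Δ + 1) * D.ncard := by
  classical
  obtain ⟨D, rfl⟩ := D.toFinite.exists_finset_coe
  rw [Set.ncard_coe_finset]
  have h := sum_card_neighbors_le G hdeg D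
  have h1 : Dᶜ.card ≤ ∑ v ∈ Dᶜ, (D.filter (G.Adj v)).card := by
    rw [Finset.card_eq_sum_ones]
    refine Finset.sum_le_sum fun v hv => Finset.card_pos.2 ?_
    obtain ⟨u, hu, huv⟩ := hD v (by simpa using hv)
    exact ⟨u, Finset.mem_filter.2 ⟨hu, huv.symm⟩⟩
  have h2 := D.card_add_card_compl
  linarith

theorem LocatingDominating.card_le {V : Type*} [Fintype V] (G : SimpleGraph V)
    [DecidableRel G.Adj] {Δ : ℕ} (hdeg : ∀ v, G.degree v ≤ Δ) {D : Set V}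
    (hD : LocatingDominating G D) : 2 * Fintype.card V ≤ (Δ + 3) * D.ncard := by
  classical
  obtain ⟨D, rfl⟩ := D.toFinite.exists_finset_coe
  rw [Set.ncard_coe_finset]
  have h := sum_card_neighbors_le G hdeg D
  set S := Dᶜ.filter fun v => (D.filter (G.Adj v)).card = 1 with hS
  have hSD : S.card ≤ D.card := by
    have key : ∀ v ∈ S, ∃ d, D.filter (G.Adj v) = {d} := fun v hv =>
      Finset.card_eq_one.1 (Finset.mem_filter.1 hv).2
    choose! f hf using key
    refine Finset.card_le_card_of_injOn f (fun v hv => ?_) (fun u hu v hv huv => ?_)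
    · have : f v ∈ D.filter (G.Adj v) := by simp [hf v hv]
      exact (Finset.mem_filter.1 this).1
    · by_contra hne
      refine hD.2 u (by simpa using (Finset.mem_filter.1 hu).1) v
        (by simpa using (Finset.mem_filter.1 hv).1) hne ?_
      have e : D.filter (G.Adj u) = D.filter (G.Adj v) := by rw [hf u hu, hf v hv, huv]
      ext x
      have := Finset.ext_iff.1 e x
      simp only [Finset.mem_filter] at this
      simpa [and_comm] using this
  have h1 : 2 * Dᶜ.card ≤ ∑ v ∈ Dᶜ, (D.filter (G.Adj v)).card + S.card := by
    rw [hS, Finset.card_filter, ← Finset.sum_add_distrib, mul_comm, ← smul_eq_mul]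
    refine Finset.card_nsmul_le_sum _ _ _ fun v hv => ?_
    have : 0 < (D.filter (G.Adj v)).card := by
      obtain ⟨u, hu, huv⟩ := hD.1 v (by simpa using hv)
      exact Finset.card_pos.2 ⟨u, Finset.mem_filter.2 ⟨hu, huv.symm⟩⟩
    split_ifs <;> omega
  have h2 := D.card_add_card_compl
  linarith

theorem cycleGraph_adj_iff_val {n : ℕ} (hn : 2 ≤ n) (u v : Fin n) :
    (cycleGraph n).Adj u v ↔ u.val + 1 = v.val ∨ v.val + 1 = u.val ∨
      (u.val = 0 ∧ v.val + 1 = n) ∨ (v.val = 0 ∧ u.val + 1 = n) := by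
  rw [cycleGraph_adj', Fin.sub_def, Fin.sub_def]
  have := u.isLt
  have := v.isLt
  dsimp only
  rcases lt_trichotomy u.val v.val with h | h | h
  · rw [Nat.mod_eq_of_lt (a := n - v.val + u.val) (by omega),
      Nat.mod_eq_sub_mod (by omega), Nat.mod_eq_of_lt (by omega)]
    omega
  · simp [h, show n - v.val + v.val = n by omega]
    omega
  · rw [Nat.mod_eq_of_lt (a := n - u.val + v.val) (by omega),
      Nat.mod_eq_sub_mod (by omega), Nat.mod_eq_of_lt (by omega)]
    omega

/-- A function that is `1`-Lipschitz along edges, vanishes only at `x`, and can be decreased by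
moving to a neighbor is the distance to `x`. -/
theorem dist_eq_of_descent {V : Type*} {G : SimpleGraph V} (hG : G.Connected) {x : V} (f : V → ℕ)
    (hx : f x = 0) (hlip : ∀ u v, G.Adj u v → f u ≤ f v + 1)
    (hdesc : ∀ u, u ≠ x → ∃ w, G.Adj u w ∧ f w + 1 = f u) (u : V) : G.dist u x = f u := by
  apply le_antisymm
  · induction h : f u using Nat.strong_induction_on generalizing u with
    | _ k ih =>
      by_cases hu : u = x
      · simp [hu]
      · obtain ⟨w, hw, hfw⟩ := hdesc u hu
        have h1 := ih (f w) (by omega) w rfl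
        have h2 := hG.dist_triangle (u := u) (v := w) (w := x)
        rw [dist_eq_one_iff_adj.2 hw] at h2
        omega
  · obtain ⟨p, hp⟩ := hG.exists_walk_length_eq_dist u x
    rw [← hp]
    clear hp
    induction p with
    | nil => simp [hx]
    | cons h p ih =>
      have := hlip _ _ h
      have := ih hx hdesc
      simp only [Walk.length_cons]
      omega

theorem cycleGraph_dist {n : ℕ} (hn : 2 ≤ n) (u x : Fin n) :
    (cycleGraph n).dist u x =
      min (max u.val x.val - min u.val x.val) (n - (max u.val x.val - min u.val x.val)) := by
  have hx := x.isLt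
  have hG : (cycleGraph n).Connected := by
    obtain ⟨m, rfl⟩ : ∃ m, n = m + 1 := ⟨n - 1, by omega⟩
    exact cycleGraph_connected
  refine dist_eq_of_descent hG (fun u : Fin n =>
    min (max u.val x.val - min u.val x.val) (n - (max u.val x.val - min u.val x.val)))
    (by simp) (fun u v huv => ?_) (fun u hu => ?_) u
  · rw [cycleGraph_adj_iff_val hn] at huv
    have := u.isLt
    have := v.isLt
    omega
  · have hu' := u.isLt
    have hne : u.val ≠ x.val := fun h => hu (Fin.ext h)
    have key : ∃ w : ℕ, ∃ hw : w < n, (u.val + 1 = w ∨ w + 1 = u.val ∨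
        (u.val = 0 ∧ w + 1 = n) ∨ (w = 0 ∧ u.val + 1 = n)) ∧
        min (max w x.val - min w x.val) (n - (max w x.val - min w x.val)) + 1 =
        min (max u.val x.val - min u.val x.val) (n - (max u.val x.val - min u.val x.val)) := by
      by_cases hup : (u.val < x.val ∧ 2 * (x.val - u.val) ≤ n) ∨
          (x.val < u.val ∧ n < 2 * (u.val - x.val))
      · by_cases hlast : u.val + 1 = n
        · exact ⟨0, by omega, by omega, by omega⟩
        · exact ⟨u.val + 1, by omega, by omega, by omega⟩
      · by_cases hzero : u.val = 0
        · exact ⟨n - 1, by omega, by omega, by omega⟩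
        · exact ⟨u.val - 1, by omega, by omega, by omega⟩
    obtain ⟨w, hw, hadj, hf⟩ := key
    exact ⟨⟨w, hw⟩, (cycleGraph_adj_iff_val hn _ _).2 hadj, hf⟩

theorem cycleGraph_degree_le_two {n : ℕ} (v : Fin n) : (cycleGraph n).degree v ≤ 2 := by
  match n with
  | 0 => exact v.elim0
  | 1 => simp [cycleGraph_one_eq_bot]
  | m + 2 =>
    rw [cycleGraph_degree_two_le]
    exact Finset.card_le_two

/-- The vertices of `C_n` congruent to `1` mod `3`, together with the last vertex unless
`3 ∣ n`. -/
def cycleDominatingSet (n : ℕ) : Set (Fin n) :=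
  {v | v.val % 3 = 1 ∨ (n % 3 ≠ 0 ∧ v.val + 1 = n)}

/-- The vertices of `C_n` congruent to `1` or `3` mod `5`, together with the last vertex unless
`5 ∣ n`. -/
def cycleLocatingDominatingSet (n : ℕ) : Set (Fin n) :=
  {v | v.val % 5 = 1 ∨ v.val % 5 = 3 ∨ (n % 5 ≠ 0 ∧ v.val + 1 = n)}

theorem ncard_cycleDominatingSet_le (n : ℕ) : (cycleDominatingSet n).ncard ≤ (n + 2) / 3 := by
  rw [← Finset.card_range ((n + 2) / 3), ← Set.ncard_coe_finset]
  refine Set.ncard_le_ncard_of_injOn (fun v => v.val / 3) (fun v hv => ?_)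
    (fun u hu v hv huv => Fin.ext ?_)
  · have := v.isLt
    simp only [cycleDominatingSet, Set.mem_ofPred_eq] at hv
    simp only [Finset.coe_range, Set.mem_Iio]
    omega
  · have := u.isLt
    have := v.isLt
    simp only [cycleDominatingSet, Set.mem_ofPred_eq] at hu hv huv
    omega

theorem ncard_cycleLocatingDominatingSet_le (n : ℕ) :
    (cycleLocatingDominatingSet n).ncard ≤ (2 * n + 4) / 5 := by
  rw [← Finset.card_range ((2 * n + 4) / 5), ← Set.ncard_coe_finset]
  refine Set.ncard_le_ncard_of_injOn (fun v => 2 * (v.val / 5) + (v.val % 5) / 2)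
    (fun v hv => ?_) (fun u hu v hv huv => Fin.ext ?_)
  · have := v.isLt
    simp only [cycleLocatingDominatingSet, Set.mem_ofPred_eq] at hv
    simp only [Finset.coe_range, Set.mem_Iio]
    have : v.val % 5 = 0 ∨ v.val % 5 = 1 ∨ v.val % 5 = 2 ∨ v.val % 5 = 3 ∨ v.val % 5 = 4 := by
      omega
    rcases this with h | h | h | h | h <;> rw [h] at hv ⊢ <;> omega
  · have := u.isLt
    have := v.isLt
    simp only [cycleLocatingDominatingSet, Set.mem_ofPred_eq] at hu hv huv
    omega

theorem dominating_cycleDominatingSet {n : ℕ} (hn : 2 ≤ n) :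
    Dominating (cycleGraph n) (cycleDominatingSet n) := by
  intro v hv
  have hlt := v.isLt
  simp only [cycleDominatingSet, Set.mem_ofPred_eq] at hv
  suffices h : ∃ w : ℕ, ∃ hw : w < n, (w % 3 = 1 ∨ (n % 3 ≠ 0 ∧ w + 1 = n)) ∧
      (w + 1 = v.val ∨ v.val + 1 = w) by
    obtain ⟨w, hw, hmem, hadj⟩ := h
    refine ⟨⟨w, hw⟩, hmem, (cycleGraph_adj_iff_val hn _ _).2 ?_⟩
    tauto
  by_cases h : v.val % 3 = 0
  · exact ⟨v.val + 1, by omega, by omega, by omega⟩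
  · exact ⟨v.val - 1, by omega, by omega, by omega⟩

theorem locating_cycleDominatingSet {n : ℕ} (hn : 6 < n) :
    Locating (cycleGraph n) (cycleDominatingSet n) := by
  intro u v huv
  have hu := u.isLt
  have hv := v.isLt
  have hne : u.val ≠ v.val := fun h => huv (Fin.ext h)
  by_contra! h
  have h1 := h ⟨1, by omega⟩ (by simp [cycleDominatingSet])
  have h4 := h ⟨4, by omega⟩ (by simp [cycleDominatingSet])
  rw [cycleGraph_dist (by omega), cycleGraph_dist (by omega)] at h1 h4
  dsimp only at h1 h4
  omega

theorem locatingDominating_cycleLocatingDominatingSet {n : ℕ} (hn : 6 < n) :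
    LocatingDominating (cycleGraph n) (cycleLocatingDominatingSet n) := by
  have hn2 : 2 ≤ n := by omega
  refine ⟨fun v hv => ?_, fun u hu v hv huv heq => ?_⟩
  · have hlt := v.isLt
    simp only [cycleLocatingDominatingSet, Set.mem_ofPred_eq] at hv
    suffices h : ∃ w : ℕ, ∃ hw : w < n, (w % 5 = 1 ∨ w % 5 = 3 ∨ (n % 5 ≠ 0 ∧ w + 1 = n)) ∧
        (w + 1 = v.val ∨ v.val + 1 = w) by
      obtain ⟨w, hw, hmem, hadj⟩ := h
      refine ⟨⟨w, hw⟩, hmem, (cycleGraph_adj_iff_val hn2 _ _).2 ?_⟩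
      tauto
    by_cases h : v.val % 5 = 0
    · exact ⟨v.val + 1, by omega, by omega, by omega⟩
    · exact ⟨v.val - 1, by omega, by omega, by omega⟩
  · have hu' := u.isLt
    have hv' := v.isLt
    have hne : u.val ≠ v.val := fun h => huv (Fin.ext h)
    wlog hlt : u.val < v.val generalizing u v
    · exact this v hv u hu huv.symm heq.symm hv' hu' hne.symm (by omega)
    have key : ∀ w : ℕ, w < n → (w % 5 = 1 ∨ w % 5 = 3 ∨ (n % 5 ≠ 0 ∧ w + 1 = n)) →
        ((u.val + 1 = w ∨ w + 1 = u.val ∨ (u.val = 0 ∧ w + 1 = n) ∨ (w = 0 ∧ u.val + 1 = n)) ↔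
        (v.val + 1 = w ∨ w + 1 = v.val ∨ (v.val = 0 ∧ w + 1 = n) ∨ (w = 0 ∧ v.val + 1 = n))) := by
      intro w hw hmem
      have := Set.ext_iff.1 heq ⟨w, hw⟩
      simp only [Set.mem_inter_iff, mem_neighborSet, cycleGraph_adj_iff_val hn2,
        cycleLocatingDominatingSet, Set.mem_ofPred_eq, hmem, and_true] at this
      exact this
    simp only [cycleLocatingDominatingSet, Set.mem_ofPred_eq] at hu hv
    by_cases h : u.val % 5 = 0
    · have h1 := key (u.val + 1) (by omega) (by omega)
      have h2 : v.val = u.val + 2 := by omega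
      have h3 := key (u.val + 3) (by omega) (by omega)
      omega
    · have h1 := key (u.val - 1) (by omega) (by omega)
      omega

theorem stmt19 (n : ℕ) (hn : 6 < n) :
    (locDomNum (SimpleGraph.cycleGraph n) : ℤ) = ⌈(2 * (n : ℚ)) / 5⌉ ∧
    (mldNum (SimpleGraph.cycleGraph n) : ℤ) = ⌈(n : ℚ) / 3⌉ := by
  have hloc : locDomNum (cycleGraph n) = (2 * n + 4) / 5 := by
    refine sInf_ncard_eq_s19 (fun D hD => ?_) (locatingDominating_cycleLocatingDominatingSet hn)
      (ncard_cycleLocatingDominatingSet_le n)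
    have := hD.card_le _ cycleGraph_degree_le_two
    rw [Fintype.card_fin] at this
    omega
  have hmld : mldNum (cycleGraph n) = (n + 2) / 3 := by
    unfold mldNum
    simp only [← and_assoc]
    refine sInf_ncard_eq_s19 (fun D hD => ?_)
      ⟨dominating_cycleDominatingSet (by omega), locating_cycleDominatingSet hn⟩
      (ncard_cycleDominatingSet_le n)
    have := hD.1.card_le _ cycleGraph_degree_le_two
    rw [Fintype.card_fin] at this
    omega
  have hceil (a b k : ℕ) (hb : 0 < b) (hle : a ≤ b * k) (hlt : b * k < a + b) :
      (k : ℤ) = ⌈(a : ℚ) / b⌉ := by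
    have hb' : (0 : ℚ) < b := by exact_mod_cast hb
    have hle' : (a : ℚ) ≤ b * k := by exact_mod_cast hle
    have hlt' : (b : ℚ) * k < a + b := by exact_mod_cast hlt
    rw [eq_comm, Int.ceil_eq_iff, lt_div_iff₀ hb', div_le_iff₀ hb']
    push_cast
    constructor <;> linarith
  rw [hloc, hmld]
  constructor
  · simpa using hceil (2 * n) 5 ((2 * n + 4) / 5) (by norm_num) (by omega) (by omega)
  · simpa using hceil n 3 ((n + 2) / 3) (by norm_num) (by omega) (by omega)
end
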